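/- arXiv:2005.08333 — 2 statements merged into one kernel-verified Lean document; each statement's English description precedes it below -/
import Mathlib

section
/- Weak–strong uniqueness with possibly infinite energy: let T > 0, let (𝐯,𝐩) be a C¹ solution of the incompressible Euler equations on [0,T]×ℝ² (∂_t𝐯 + div(𝐯⊗𝐯) + ∇𝐩 = 0, div 𝐯 = 0 pointwise) with 𝐯, 𝐩 bounded and ∫₀^T ‖(∇_sym 𝐯(τ))⁻‖_{L^∞} dτ < ∞, where ∇_sym𝐯 = ½(∇𝐯 + ∇𝐯ᵗ) and A⁻ denotes the negative part of a symmetric matrix A. Let (v,p) ∈ L^∞([0,T]×ℝ²;ℝ²×ℝ) be a weak solution of the incompressible Euler equations with the same initial datum v(0) = 𝐯(0), whose dissipation pairing ⟨D(t),ψ⟩ := ∫₀^t ∫ (e∂_tψ + (e+p)v·∇ψ) dx dτ − ∫ e(t)ψ(t) dx + ∫ e(0)ψ(0) dx (e := ½|v|²) satisfies: there is a compact set K such that ⟨D(t),ψ⟩ ≥ 0 for every t ∈ [0,T] and every ψ ∈ C¹_c(ℝ³) with 0 ≤ ψ ≤ 1 and ψ ≡ 1 on a neighborhood of K. Assume further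 the decay conditions ∫₀^t ∫_{B_{M+1}\B_M} |v−𝐯|² dx dτ → 0 and ∫₀^t ∫_{B_{M+1}\B_M} |v−𝐯||p−𝐩| dx dτ → 0 as M → ∞, for every t ∈ [0,T]. Then v = 𝐯 almost everywhere on [0,T]×ℝ². -/
open MeasureTheory Real Filter Topology

noncomputable section

/-- Real dot product of two complex numbers viewed as vectors in `ℝ²`. -/
def dotR2 (z w : ℂ) : ℝ := z.re * w.re + z.im * w.im

/-- Divergence of a vector field `w : ℂ → ℂ` on `ℝ² ≅ ℂ`. -/
def divR2 (w : ℂ → ℂ) (x : ℂ) : ℝ :=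
  (fderiv ℝ w x 1).re + (fderiv ℝ w x Complex.I).im

/-- Spatial divergence of a time-dependent `ℝ²`-valued field `Ψ : ℝ × ℂ → ℂ`. -/
def spaceDiv (Ψ : ℝ × ℂ → ℂ) (q : ℝ × ℂ) : ℝ :=
  (fderiv ℝ Ψ q ((0 : ℝ), (1 : ℂ))).re + (fderiv ℝ Ψ q ((0 : ℝ), Complex.I)).im

/-- `(v, p)` is a bounded measurable weak solution of the 2D incompressible
Euler equations on `[0,T]` with initial datum `v₀`. -/
def IsWeakEulerSolution (T : ℝ) (v : ℝ → ℂ → ℂ) (p : ℝ → ℂ → ℝ) (v₀ : ℂ → ℂ) : Prop :=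
  Measurable (Function.uncurry v) ∧ Measurable (Function.uncurry p) ∧
  (∃ Cb : ℝ, ∀ t x, ‖v t x‖ ≤ Cb ∧ |p t x| ≤ Cb) ∧
  (∀ t ∈ Set.Icc (0 : ℝ) T, ∀ ψ : ℂ → ℝ, ContDiff ℝ 1 ψ → HasCompactSupport ψ →
    (∫ x : ℂ, fderiv ℝ ψ x (v t x)) = 0) ∧
  (∀ Ψ : ℝ × ℂ → ℂ, ContDiff ℝ 1 Ψ → HasCompactSupport Ψ →
    ∀ t ∈ Set.Icc (0 : ℝ) T,
      (∫ τ in (0:ℝ)..t, ∫ x : ℂ,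
          (dotR2 (v τ x) (fderiv ℝ Ψ (τ, x) ((1 : ℝ), (0 : ℂ)))
            + dotR2 (v τ x) (fderiv ℝ Ψ (τ, x) ((0 : ℝ), v τ x))
            + p τ x * spaceDiv Ψ (τ, x))) =
        (∫ x : ℂ, dotR2 (v t x) (Ψ (t, x))) - ∫ x : ℂ, dotR2 (v₀ x) (Ψ (0, x))) ∧
  (∀ φ : ℂ → ℂ, Integrable φ →
    ContinuousOn (fun t => ∫ x : ℂ, dotR2 (v t x) (φ x)) (Set.Icc (0 : ℝ) T))

/-- The dissipation pairing `⟨D(t), ψ⟩` of a weak solution `(v, p)`, with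
kinetic energy density `e = ½|v|²`. -/
def dissipationPairing (v : ℝ → ℂ → ℂ) (p : ℝ → ℂ → ℝ) (t : ℝ) (ψ : ℝ × ℂ → ℝ) : ℝ :=
  (∫ τ in (0:ℝ)..t, ∫ x : ℂ,
      ((1 / 2) * ‖v τ x‖ ^ 2 * fderiv ℝ ψ (τ, x) ((1 : ℝ), (0 : ℂ))
        + ((1 / 2) * ‖v τ x‖ ^ 2 + p τ x) * fderiv ℝ ψ (τ, x) ((0 : ℝ), v τ x)))
    - (∫ x : ℂ, (1 / 2) * ‖v t x‖ ^ 2 * ψ (t, x))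
    + ∫ x : ℂ, (1 / 2) * ‖v 0 x‖ ^ 2 * ψ (0, x)

/-- Measurable space-time functions that are bounded on `[0,T] × B` for every ball `B`. -/
def LocBdd (T : ℝ) (F : ℝ × ℂ → ℝ) : Prop :=
  Measurable F ∧ ∀ R : ℝ, ∃ C : ℝ, ∀ t ∈ Set.Icc (0 : ℝ) T, ∀ x : ℂ, ‖x‖ ≤ R → |F (t, x)| ≤ C

lemma LocBdd.of_continuous_comp {T : ℝ} {v : ℝ → ℂ → ℂ} {p : ℝ → ℂ → ℝ}
    (hv : Measurable (Function.uncurry v)) (hp : Measurable (Function.uncurry p))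
    (hb : ∃ Cb : ℝ, ∀ t x, ‖v t x‖ ≤ Cb ∧ |p t x| ≤ Cb)
    {G : (ℝ × ℂ) × ℂ × ℝ → ℝ} (hG : Continuous G) :
    LocBdd T (fun q => G (q, v q.1 q.2, p q.1 q.2)) := by
  refine ⟨hG.measurable.comp (measurable_id.prodMk (hv.prodMk hp)), fun R => ?_⟩
  obtain ⟨B, hB⟩ := hb
  have hc : IsCompact ((Set.Icc (0 : ℝ) T ×ˢ Metric.closedBall (0 : ℂ) R) ×ˢ
      (Metric.closedBall (0 : ℂ) B ×ˢ Metric.closedBall (0 : ℝ) B)) :=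
    (isCompact_Icc.prod (isCompact_closedBall _ _)).prod
      ((isCompact_closedBall _ _).prod (isCompact_closedBall _ _))
  obtain ⟨C, hC⟩ := hc.exists_bound_of_continuousOn hG.continuousOn
  refine ⟨C, fun t ht x hx => hC _ ⟨⟨ht, by simpa using hx⟩, ?_, ?_⟩⟩
  · simpa using (hB t x).1
  · simpa using (hB t x).2

lemma LocBdd.of_continuous {T : ℝ} {F : ℝ × ℂ → ℝ} (hF : Continuous F) : LocBdd T F :=
  LocBdd.of_continuous_comp (v := fun _ _ => 0) (p := fun _ _ => 0) (by fun_prop) (by fun_prop)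
    ⟨0, by simp⟩ (G := fun z => F z.1) (by fun_prop)

section
variable {T t R : ℝ} {F : ℝ × ℂ → ℝ} {S : Set ℂ}

lemma LocBdd.integrable_prod_restrict (hF : LocBdd T F) (ht : t ≤ T)
    (hSR : S ⊆ Metric.closedBall 0 R) (hSm : MeasurableSet S) :
    Integrable F ((volume.restrict (Set.Ioc 0 t)).prod (volume.restrict S)) := by
  obtain ⟨C, hC⟩ := hF.2 R
  have : IsFiniteMeasure (volume.restrict S) :=
    ⟨by
      rw [Measure.restrict_apply_univ]
      exact (measure_mono hSR).trans_lt measure_closedBall_lt_top⟩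
  refine Integrable.of_bound hF.1.aestronglyMeasurable C ?_
  rw [Measure.prod_restrict]
  filter_upwards [ae_restrict_mem (measurableSet_Ioc.prod hSm)] with q hq
  exact hC q.1 ⟨hq.1.1.le, hq.1.2.trans ht⟩ q.2 (by simpa using hSR hq.2)

lemma LocBdd.integrable_prod (hF : LocBdd T F) (ht : t ≤ T)
    (hz : ∀ τ x, R < ‖x‖ → F (τ, x) = 0) :
    Integrable F ((volume.restrict (Set.Ioc 0 t)).prod volume) := by
  have h := hF.integrable_prod_restrict ht subset_rfl
    (Metric.isClosed_closedBall (x := (0 : ℂ)) (ε := R)).measurableSet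
  have e : (volume.restrict (Set.Ioc 0 t)).prod (volume.restrict (Metric.closedBall (0 : ℂ) R)) =
      ((volume.restrict (Set.Ioc 0 t)).prod volume).restrict
        (Set.univ ×ˢ Metric.closedBall (0 : ℂ) R) := by
    rw [← Measure.prod_restrict, Measure.restrict_univ]
  rw [e] at h
  refine (integrableOn_iff_integrable_of_support_subset ?_).1 h
  rintro ⟨τ, x⟩ hq
  refine ⟨trivial, ?_⟩
  by_contra hx
  exact hq (hz τ x (by simpa using hx))

lemma LocBdd.integrableOn_slice (hF : LocBdd T F) (ht : t ∈ Set.Icc 0 T)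
    (hSR : S ⊆ Metric.closedBall 0 R) (hSm : MeasurableSet S) :
    IntegrableOn (fun x => F (t, x)) S := by
  obtain ⟨C, hC⟩ := hF.2 R
  have hfin : volume S < ⊤ := (measure_mono hSR).trans_lt measure_closedBall_lt_top
  have : IsFiniteMeasure (volume.restrict S) := ⟨by rwa [Measure.restrict_apply_univ]⟩
  refine Integrable.of_bound (hF.1.comp measurable_prodMk_left).aestronglyMeasurable C ?_
  filter_upwards [ae_restrict_mem hSm] with x hx
  exact hC t ht x (by simpa using hSR hx)

lemma LocBdd.integrable_slice (hF : LocBdd T F) (ht : t ∈ Set.Icc 0 T)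
    (hz : ∀ τ x, R < ‖x‖ → F (τ, x) = 0) :
    Integrable (fun x => F (t, x)) := by
  refine (integrableOn_iff_integrable_of_support_subset ?_).1
    (hF.integrableOn_slice ht subset_rfl
      (Metric.isClosed_closedBall (x := (0 : ℂ)) (ε := R)).measurableSet)
  intro x hq
  by_contra hx
  exact hq (hz t x (by simpa using hx))

lemma LocBdd.exists_bound_integral (hF : LocBdd T F)
    (hz : ∀ τ x, R < ‖x‖ → F (τ, x) = 0) :
    ∃ C, ∀ t ∈ Set.Icc 0 T, |∫ x, F (t, x)| ≤ C := by
  obtain ⟨C, hC⟩ := hF.2 R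
  refine ⟨C * volume.real (Metric.closedBall (0 : ℂ) R), fun t ht => ?_⟩
  have : ∫ x, F (t, x) = ∫ x in Metric.closedBall (0 : ℂ) R, F (t, x) := by
    rw [setIntegral_eq_integral_of_forall_compl_eq_zero]
    intro x hx
    exact hz t x (by simpa using hx)
  rw [this]
  exact norm_setIntegral_le_of_norm_le_const (f := fun x => F (t, x)) measure_closedBall_lt_top
    (fun x hx => hC t ht x (mem_closedBall_zero_iff.1 hx))

lemma LocBdd.intervalIntegrable (hF : LocBdd T F) (ht0 : 0 ≤ t) (ht : t ≤ T)
    (hz : ∀ τ x, R < ‖x‖ → F (τ, x) = 0) :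
    IntervalIntegrable (fun τ => ∫ x, F (τ, x)) volume 0 t := by
  rw [intervalIntegrable_iff_integrableOn_Ioc_of_le ht0]
  exact (hF.integrable_prod ht hz).integral_prod_left

lemma LocBdd.intervalIntegrable_restrict (hF : LocBdd T F) (ht0 : 0 ≤ t) (ht : t ≤ T)
    (hSR : S ⊆ Metric.closedBall 0 R) (hSm : MeasurableSet S) :
    IntervalIntegrable (fun τ => ∫ x in S, F (τ, x)) volume 0 t := by
  rw [intervalIntegrable_iff_integrableOn_Ioc_of_le ht0]
  exact (hF.integrable_prod_restrict ht hSR hSm).integral_prod_left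

end

/-- A Grönwall-type step: on an interval where the kernel has mass at most `1/2`, the integral
bound at most doubles. -/
lemma gronwall_step {a b A : ℝ} (hab : a ≤ b) {k E : ℝ → ℝ}
    (hk : IntervalIntegrable k volume a b) (hkE : IntervalIntegrable (fun s => k s * E s) volume a b)
    (hk0 : ∀ s ∈ Set.Icc a b, 0 ≤ k s) (hmass : ∫ s in a..b, k s ≤ 1 / 2)
    (hbdd : ∃ C, ∀ s ∈ Set.Icc a b, E s ≤ C) (hE0 : ∀ s ∈ Set.Icc a b, 0 ≤ E s)
    (hE : ∀ t ∈ Set.Icc a b, E t ≤ A + ∫ s in a..t, k s * E s) :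
    ∫ s in a..b, k s * E s ≤ A := by
  obtain ⟨C, hC⟩ := hbdd
  have hne : (E '' Set.Icc a b).Nonempty := ⟨E a, a, ⟨le_rfl, hab⟩, rfl⟩
  have hbd : BddAbove (E '' Set.Icc a b) := ⟨C, by rintro _ ⟨s, hs, rfl⟩; exact hC s hs⟩
  set S := sSup (E '' Set.Icc a b)
  have hS : ∀ s ∈ Set.Icc a b, E s ≤ S := fun s hs => le_csSup hbd ⟨s, hs, rfl⟩
  have hS0 : 0 ≤ S := (hE0 a ⟨le_rfl, hab⟩).trans (hS a ⟨le_rfl, hab⟩)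
  have h1 : ∫ s in a..b, k s * E s ≤ 1 / 2 * S := by
    calc ∫ s in a..b, k s * E s ≤ ∫ s in a..b, k s * S :=
          intervalIntegral.integral_mono_on hab hkE (hk.mul_const S)
            fun s hs => mul_le_mul_of_nonneg_left (hS s hs) (hk0 s hs)
      _ = (∫ s in a..b, k s) * S := intervalIntegral.integral_mul_const _ _
      _ ≤ 1 / 2 * S := by gcongr
  have h2 : S ≤ A + ∫ s in a..b, k s * E s := by
    refine csSup_le hne ?_
    rintro _ ⟨t, ht, rfl⟩
    refine (hE t ht).trans ?_
    gcongr
    refine intervalIntegral.integral_mono_interval le_rfl ht.1 ht.2 ?_ hkE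
    filter_upwards [ae_restrict_mem measurableSet_Ioc] with s hs
    exact mul_nonneg (hk0 s ⟨hs.1.le, hs.2⟩) (hE0 s ⟨hs.1.le, hs.2⟩)
  linarith

/-- Sequential Grönwall lemma with an integrable kernel and no continuity assumption. -/
lemma gronwall_tendsto {T : ℝ} (hT : 0 ≤ T) {k : ℝ → ℝ} (hk : IntervalIntegrable k volume 0 T)
    (hk0 : ∀ s ∈ Set.Icc 0 T, 0 ≤ k s) {E : ℕ → ℝ → ℝ} {ε : ℕ → ℝ}
    (hkE : ∀ n, IntervalIntegrable (fun s => k s * E n s) volume 0 T)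
    (hbdd : ∀ n, ∃ C, ∀ s ∈ Set.Icc 0 T, E n s ≤ C) (hE0 : ∀ n, ∀ s ∈ Set.Icc 0 T, 0 ≤ E n s)
    (hE : ∀ᶠ n in atTop, ∀ t ∈ Set.Icc 0 T, E n t ≤ ε n + ∫ s in (0 : ℝ)..t, k s * E n s)
    (hε : Tendsto ε atTop (𝓝 0)) :
    ∀ t ∈ Set.Icc 0 T, Tendsto (fun n => E n t) atTop (𝓝 0) := by
  have sub : ∀ {f : ℝ → ℝ}, IntervalIntegrable f volume 0 T → ∀ a ∈ Set.Icc 0 T,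
      ∀ b ∈ Set.Icc 0 T, IntervalIntegrable f volume a b := fun hf a ha b hb =>
    hf.mono_set (by
      rw [Set.uIcc_of_le hT]
      exact Set.uIcc_subset_Icc ha hb)
  have h0 : (0 : ℝ) ∈ Set.Icc 0 T := ⟨le_rfl, hT⟩
  have hcont : ContinuousOn (fun t => ∫ s in (0 : ℝ)..t, k s) (Set.Icc 0 T) := by
    have := intervalIntegral.continuousOn_primitive_interval
      (f := k) (μ := volume) (a := 0) (b := T)
      (by rw [Set.uIcc_of_le hT]; exact (intervalIntegrable_iff_integrableOn_Icc_of_le hT).1 hk)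
    rwa [Set.uIcc_of_le hT] at this
  obtain ⟨δ, hδ, hu⟩ := Metric.uniformContinuousOn_iff.1
    (isCompact_Icc.uniformContinuousOn_of_continuous hcont) (1 / 2) (by norm_num)
  set F : ℕ → ℝ → ℝ := fun n t => ε n + ∫ s in (0 : ℝ)..t, k s * E n s with hF
  have step : ∀ a ∈ Set.Icc 0 T, ∀ b ∈ Set.Icc 0 T, a ≤ b → b - a < δ →
      ∀ᶠ n in atTop, F n b ≤ 2 * F n a := by
    intro a ha b hb hab hd
    filter_upwards [hE] with n hn
    have hs : ∀ s ∈ Set.Icc a b, s ∈ Set.Icc 0 T := fun s hs => ⟨ha.1.trans hs.1, hs.2.trans hb.2⟩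
    have hadd : ∀ t ∈ Set.Icc 0 T, F n t = F n a + ∫ s in a..t, k s * E n s := by
      intro t ht
      simp only [hF]
      rw [add_assoc, intervalIntegral.integral_add_adjacent_intervals (sub (hkE n) _ h0 _ ha)
        (sub (hkE n) _ ha _ ht)]
    have hm : ∫ s in a..b, k s ≤ 1 / 2 := by
      have h1 := hu b hb a ha (by rwa [Real.dist_eq, abs_of_nonneg (by linarith)])
      rw [Real.dist_eq] at h1
      rw [← intervalIntegral.integral_interval_sub_left (sub hk _ h0 _ hb) (sub hk _ h0 _ ha)]
      exact (le_abs_self _).trans h1.le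
    obtain ⟨C, hC⟩ := hbdd n
    have := gronwall_step (A := F n a) hab (sub hk _ ha _ hb) (sub (hkE n) _ ha _ hb)
      (fun s h => hk0 s (hs s h)) hm ⟨C, fun s h => hC s (hs s h)⟩ (fun s h => hE0 n s (hs s h))
      (fun t ht => (hn t (hs t ht)).trans_eq (hadd t (hs t ht)))
    rw [hadd b hb]
    linarith
  have key : ∀ N : ℕ, ∀ t ∈ Set.Icc 0 T, t ≤ N * (δ / 2) →
      ∃ C : ℝ, ∀ᶠ n in atTop, F n t ≤ C * ε n := by
    intro N
    induction N with
    | zero =>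
      intro t ht h
      have : t = 0 := le_antisymm (by simpa using h) ht.1
      subst this
      exact ⟨1, by simp [hF]⟩
    | succ N ih =>
      intro t ht h
      have ha : max 0 (t - δ / 2) ∈ Set.Icc 0 T :=
        ⟨le_max_left _ _, max_le hT (by linarith [ht.2])⟩
      obtain ⟨C, hC⟩ := ih _ ha (max_le (by positivity) (by push_cast at h; linarith))
      refine ⟨2 * C, ?_⟩
      filter_upwards [hC, step _ ha t ht (max_le ht.1 (by linarith))
        (by linarith [le_max_right 0 (t - δ / 2)])] with n h1 h2
      linarith
  intro t ht
  obtain ⟨N, hN⟩ := exists_nat_ge (t / (δ / 2))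
  obtain ⟨C, hC⟩ := key N t ht ((div_le_iff₀ (by positivity)).1 hN)
  refine tendsto_of_tendsto_of_tendsto_of_le_of_le' tendsto_const_nhds
    (by simpa using hε.const_mul C) (Eventually.of_forall fun n => hE0 n t ht) ?_
  filter_upwards [hC, hE] with n h1 h2
  exact (h2 t ht).trans h1

lemma hasFDerivAt_slice {F : Type*} [NormedAddCommGroup F] [NormedSpace ℝ F] {f : ℝ × ℂ → F}
    (hf : ContDiff ℝ 1 f) (t : ℝ) (x : ℂ) :
    HasFDerivAt (fun y => f (t, y))
      ((fderiv ℝ f (t, x)).comp (ContinuousLinearMap.inr ℝ ℝ ℂ)) x :=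
  ((hf.differentiable one_ne_zero (t, x)).hasFDerivAt).comp x (hasFDerivAt_prodMk_right t x)

lemma fderiv_slice_apply {F : Type*} [NormedAddCommGroup F] [NormedSpace ℝ F] {f : ℝ × ℂ → F}
    (hf : ContDiff ℝ 1 f) (t : ℝ) (x ξ : ℂ) :
    fderiv ℝ (fun y => f (t, y)) x ξ = fderiv ℝ f (t, x) ((0 : ℝ), ξ) := by
  rw [(hasFDerivAt_slice hf t x).fderiv]
  simp

lemma fderiv_re_apply {u : ℂ → ℂ} {x : ℂ} (hu : DifferentiableAt ℝ u x) (ξ : ℂ) :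
    fderiv ℝ (fun y => (u y).re) x ξ = (fderiv ℝ u x ξ).re := by
  have := (Complex.reCLM.hasFDerivAt.comp x hu.hasFDerivAt).fderiv
  exact congrArg (fun L => L ξ) this

lemma fderiv_im_apply {u : ℂ → ℂ} {x : ℂ} (hu : DifferentiableAt ℝ u x) (ξ : ℂ) :
    fderiv ℝ (fun y => (u y).im) x ξ = (fderiv ℝ u x ξ).im := by
  have := (Complex.imCLM.hasFDerivAt.comp x hu.hasFDerivAt).fderiv
  exact congrArg (fun L => L ξ) this

lemma clm_apply_eq_re_im {F : Type*} [NormedAddCommGroup F] [NormedSpace ℝ F] (L : ℂ →L[ℝ] F)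
    (z : ℂ) : L z = z.re • L 1 + z.im • L Complex.I := by
  conv_lhs => rw [show z = z.re • (1 : ℂ) + z.im • Complex.I by simp [Complex.re_add_im]]
  rw [map_add, map_smul, map_smul]

/-- A `C¹` pointwise divergence-free field is weakly divergence-free. -/
lemma integral_fderiv_apply_eq_zero {u : ℂ → ℂ} (hu : ContDiff ℝ 1 u)
    (hdiv : ∀ x, divR2 u x = 0) {ψ : ℂ → ℝ} (hψ : ContDiff ℝ 1 ψ) (hc : HasCompactSupport ψ) :
    ∫ x, fderiv ℝ ψ x (u x) = 0 := by
  have hud := hu.differentiable one_ne_zero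
  have hure : ContDiff ℝ 1 (fun y => (u y).re) := Complex.reCLM.contDiff.comp hu
  have huim : ContDiff ℝ 1 (fun y => (u y).im) := Complex.imCLM.contDiff.comp hu
  have hψ' : Continuous (fderiv ℝ ψ) := hψ.continuous_fderiv one_ne_zero
  have hc' : HasCompactSupport (fderiv ℝ ψ) := hc.fderiv ℝ
  have hca : ∀ ξ : ℂ, HasCompactSupport (fun x => fderiv ℝ ψ x ξ) := fun ξ => hc.fderiv_apply ℝ ξ
  have parts : ∀ (f : ℂ → ℝ) (_ : ContDiff ℝ 1 f) (ξ : ℂ),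
      ∫ x, fderiv ℝ ψ x ξ * f x = - ∫ x, ψ x * fderiv ℝ f x ξ := by
    intro f hf ξ
    have hf' : Continuous (fderiv ℝ f) := hf.continuous_fderiv one_ne_zero
    have hfc := hf.continuous
    have hψc := hψ.continuous
    rw [integral_mul_fderiv_eq_neg_fderiv_mul_of_integrable (𝕜 := ℝ) (f := ψ) ?_ ?_ ?_
      (fun x _ => hψ.differentiable one_ne_zero x) (fun x _ => hf.differentiable one_ne_zero x), neg_neg]
    · exact Continuous.integrable_of_hasCompactSupport (by fun_prop) (hca ξ).mul_right
    · exact Continuous.integrable_of_hasCompactSupport (by fun_prop) hc.mul_right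
    · exact Continuous.integrable_of_hasCompactSupport (by fun_prop) hc.mul_right
  have hurec := hure.continuous
  have huimc := huim.continuous
  have hu' : Continuous (fderiv ℝ u) := hu.continuous_fderiv one_ne_zero
  have hψc := hψ.continuous
  have e : ∀ x, fderiv ℝ ψ x (u x) = fderiv ℝ ψ x 1 * (u x).re + fderiv ℝ ψ x Complex.I * (u x).im := by
    intro x
    rw [clm_apply_eq_re_im]
    simp only [smul_eq_mul]; ring
  simp_rw [e]
  rw [integral_add, parts _ hure, parts _ huim, ← neg_add, ← integral_add, neg_eq_zero,
    ← integral_zero ℂ ℝ]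
  · congr 1
    funext x
    rw [fderiv_re_apply (hud x), fderiv_im_apply (hud x), ← mul_add]
    have := hdiv x
    unfold divR2 at this
    rw [this, mul_zero]
  · simp_rw [fun x => fderiv_re_apply (hud x)]
    exact Continuous.integrable_of_hasCompactSupport (by fun_prop) hc.mul_right
  · simp_rw [fun x => fderiv_im_apply (hud x)]
    exact Continuous.integrable_of_hasCompactSupport (by fun_prop) hc.mul_right
  · exact Continuous.integrable_of_hasCompactSupport (by fun_prop) (hca _).mul_right
  · exact Continuous.integrable_of_hasCompactSupport (by fun_prop) (hca _).mul_right

/-- The Euler momentum equation in non-conservative form, tested against a vector `η`. -/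
lemma euler_dot {V : ℝ × ℂ → ℂ} {P : ℝ × ℂ → ℝ} (hV : ContDiff ℝ 1 V) (hP : ContDiff ℝ 1 P)
    {t : ℝ} {x : ℂ} (hdiv : divR2 (fun y => V (t, y)) x = 0)
    (hE : fderiv ℝ V (t, x) ((1 : ℝ), (0 : ℂ))
        + (((divR2 (fun y => (V (t, y)).re • V (t, y)) x : ℝ) : ℂ)
            + ((divR2 (fun y => (V (t, y)).im • V (t, y)) x : ℝ) : ℂ) * Complex.I)
        + (((fderiv ℝ (fun y => P (t, y)) x 1 : ℝ) : ℂ)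
            + ((fderiv ℝ (fun y => P (t, y)) x Complex.I : ℝ) : ℂ) * Complex.I) = 0) (η : ℂ) :
    dotR2 η (fderiv ℝ V (t, x) ((1 : ℝ), (0 : ℂ)))
      + dotR2 η (fderiv ℝ V (t, x) ((0 : ℝ), V (t, x)))
      + fderiv ℝ P (t, x) ((0 : ℝ), η) = 0 := by
  have hu := (hasFDerivAt_slice hV t x)
  have hud := hu.differentiableAt
  have hre : HasFDerivAt (fun y => (V (t, y)).re) _ x := Complex.reCLM.hasFDerivAt.comp x hu
  have him : HasFDerivAt (fun y => (V (t, y)).im) _ x := Complex.imCLM.hasFDerivAt.comp x hu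
  have h1 : divR2 (fun y => (V (t, y)).re • V (t, y)) x =
      (fderiv ℝ V (t, x) ((0 : ℝ), V (t, x))).re := by
    have e := clm_apply_eq_re_im (fderiv ℝ (fun y => V (t, y)) x) (V (t, x))
    rw [fderiv_slice_apply hV] at e
    rw [e]
    unfold divR2 at hdiv ⊢
    rw [HasFDerivAt.fderiv (f := fun y => (V (t, y)).re • V (t, y)) (hre.smul hu)]
    simp only [fderiv_slice_apply hV] at hdiv ⊢
    simp
    linear_combination (V (t, x)).re * hdiv
  have h2 : divR2 (fun y => (V (t, y)).im • V (t, y)) x =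
      (fderiv ℝ V (t, x) ((0 : ℝ), V (t, x))).im := by
    have e := clm_apply_eq_re_im (fderiv ℝ (fun y => V (t, y)) x) (V (t, x))
    rw [fderiv_slice_apply hV] at e
    rw [e]
    unfold divR2 at hdiv ⊢
    rw [HasFDerivAt.fderiv (f := fun y => (V (t, y)).im • V (t, y)) (him.smul hu)]
    simp only [fderiv_slice_apply hV] at hdiv ⊢
    simp
    linear_combination (V (t, x)).im * hdiv
  have h3 := clm_apply_eq_re_im (fderiv ℝ (fun y => P (t, y)) x) η
  rw [fderiv_slice_apply hP] at h3
  rw [h1, h2] at hE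
  have r := congrArg Complex.re hE
  have i := congrArg Complex.im hE
  rw [h3]
  simp at r i
  simp only [dotR2, smul_eq_mul]
  linear_combination η.re * r + η.im * i

/-- Smooth radial cutoffs equal to `1` on `B_M`, vanishing off `B_{M+1}`, with gradients bounded
uniformly in `M`. -/
lemma exists_cutoff : ∃ C : ℝ, 0 ≤ C ∧ ∀ M : ℕ, ∃ χ : ℂ → ℝ, ContDiff ℝ 1 χ ∧
    (∀ x, 0 ≤ χ x ∧ χ x ≤ 1) ∧ (∀ x, ‖x‖ ≤ M → χ x = 1) ∧ (∀ x, M + 1 ≤ ‖x‖ → χ x = 0) ∧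
    (∀ x, ‖fderiv ℝ χ x‖ ≤ C) ∧
    (∀ x, x ∉ Metric.ball (0 : ℂ) (M + 1) \ Metric.ball (0 : ℂ) M → fderiv ℝ χ x = 0) := by
  have hsm : ContDiff ℝ 1 smoothTransition := smoothTransition.contDiff
  have hdc : Continuous (deriv smoothTransition) := hsm.continuous_deriv le_rfl
  obtain ⟨C, hC⟩ := (isCompact_Icc (a := (0 : ℝ)) (b := 1)).exists_bound_of_continuousOn
    hdc.continuousOn
  have hC0 : 0 ≤ C := (norm_nonneg _).trans (hC 0 ⟨le_rfl, zero_le_one⟩)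
  refine ⟨C * 2, by positivity, fun M => ?_⟩
  set h : ℂ → ℝ := fun x => ((M + 1 : ℝ) ^ 2 - ‖x‖ ^ 2) / (2 * M + 1) with hh
  have hpos : (0 : ℝ) < 2 * M + 1 := by positivity
  have hder : ∀ x, HasFDerivAt h ((2 * M + 1 : ℝ)⁻¹ • -(2 • innerSL ℝ x : ℂ →L[ℝ] ℝ)) x := by
    intro x
    have := ((hasStrictFDerivAt_norm_sq (F := ℂ) x).hasFDerivAt.const_sub ((M + 1 : ℝ) ^ 2)).const_mul
      (2 * M + 1 : ℝ)⁻¹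
    refine this.congr_of_eventuallyEq (Eventually.of_forall fun y => ?_)
    simp only [hh]
    rw [div_eq_inv_mul]
  have hcd : ContDiff ℝ 1 h := by
    have := contDiff_norm_sq ℝ (E := ℂ) (n := 1)
    exact (contDiff_const.sub this).div_const _
  have hzero : ∀ x, (M : ℝ) + 1 ≤ ‖x‖ → smoothTransition (h x) = 0 := fun x hx => by
    apply smoothTransition.zero_of_nonpos
    apply div_nonpos_of_nonpos_of_nonneg _ hpos.le
    nlinarith [(Nat.cast_nonneg M : (0 : ℝ) ≤ M)]
  have hone : ∀ x, ‖x‖ ≤ (M : ℝ) → smoothTransition (h x) = 1 := fun x hx => by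
    apply smoothTransition.one_of_one_le
    rw [hh, le_div_iff₀ hpos]
    nlinarith [norm_nonneg x]
  have hoff : ∀ x, x ∉ Metric.ball (0 : ℂ) (M + 1) \ Metric.ball (0 : ℂ) M →
      fderiv ℝ (fun x => smoothTransition (h x)) x = 0 := by
    intro x hx
    by_cases h1 : x ∈ Metric.ball (0 : ℂ) M
    · have : (fun x => smoothTransition (h x)) =ᶠ[𝓝 x] fun _ => 1 := by
        filter_upwards [Metric.isOpen_ball.mem_nhds h1] with y hy
        exact hone y (mem_ball_zero_iff.1 hy).le
      rw [this.fderiv_eq]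
      simp
    · have h2 : x ∉ Metric.ball (0 : ℂ) (M + 1) := fun h => hx ⟨h, h1⟩
      have h3 : smoothTransition (h x) = 0 := hzero x (by simpa using h2)
      apply IsLocalMin.fderiv_eq_zero
      refine Eventually.of_forall fun y => ?_
      simp only [h3]
      exact smoothTransition.nonneg _
  refine ⟨fun x => smoothTransition (h x), hsm.comp hcd,
    fun x => ⟨smoothTransition.nonneg _, smoothTransition.le_one _⟩, hone, hzero, ?_, hoff⟩
  intro x
  by_cases hx : x ∈ Metric.ball (0 : ℂ) (M + 1) \ Metric.ball (0 : ℂ) M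
  · have hd : HasFDerivAt (fun x => smoothTransition (h x)) _ x :=
      ((hsm.differentiable one_ne_zero (h x)).hasDerivAt).comp_hasFDerivAt x (hder x)
    have hx1 : ‖x‖ < M + 1 := mem_ball_zero_iff.1 hx.1
    have hx2 : (M : ℝ) ≤ ‖x‖ := by simpa using hx.2
    have hmem : h x ∈ Set.Icc (0 : ℝ) 1 := by
      constructor
      · rw [hh]
        apply div_nonneg _ hpos.le
        nlinarith [norm_nonneg x]
      · rw [hh, div_le_iff₀ hpos]
        nlinarith [(Nat.cast_nonneg M : (0 : ℝ) ≤ M)]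
    rw [hd.fderiv, norm_smul]
    refine mul_le_mul (hC _ hmem) ?_ (norm_nonneg _) hC0
    rw [norm_smul, norm_neg, norm_inv, Real.norm_of_nonneg hpos.le, ← Nat.cast_smul_eq_nsmul ℝ,
      norm_smul, innerSL_apply_norm, inv_mul_le_iff₀ hpos]
    simp
    linarith
  · simp only [hoff x hx, norm_zero]
    positivity

@[fun_prop]
lemma Continuous.dotR2 {X : Type*} [TopologicalSpace X] {f g : X → ℂ} (hf : Continuous f)
    (hg : Continuous g) : Continuous fun x => dotR2 (f x) (g x) := by
  unfold _root_.dotR2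
  fun_prop

lemma dotR2_self (z : ℂ) : dotR2 z z = ‖z‖ ^ 2 := by
  rw [Complex.sq_norm, Complex.normSq_apply, dotR2]

lemma hasFDerivAt_dotR2_self {u : ℂ → ℂ} {L : ℂ →L[ℝ] ℂ} {x : ℂ} (hu : HasFDerivAt u L x) :
    ∃ L' : ℂ →L[ℝ] ℝ, HasFDerivAt (fun y => 1 / 2 * dotR2 (u y) (u y)) L' x ∧
      ∀ ξ, L' ξ = dotR2 (u x) (L ξ) := by
  have hre : HasFDerivAt (fun y => (u y).re) _ x := Complex.reCLM.hasFDerivAt.comp x hu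
  have him : HasFDerivAt (fun y => (u y).im) _ x := Complex.imCLM.hasFDerivAt.comp x hu
  refine ⟨_, ((hre.mul hre).add (him.mul him)).const_mul (1 / 2), fun ξ => ?_⟩
  simp [dotR2]
  ring

/-- Time evolution of the localized kinetic energy of a `C¹` field. -/
lemma integral_energy_sub {V : ℝ × ℂ → ℂ} (hV : ContDiff ℝ 1 V) {χ : ℂ → ℝ} (hχ : Continuous χ)
    {R : ℝ} (hz : ∀ x, R < ‖x‖ → χ x = 0) {t : ℝ} (ht : 0 ≤ t) :
    (∫ x, 1 / 2 * ‖V (t, x)‖ ^ 2 * χ x) - ∫ x, 1 / 2 * ‖V (0, x)‖ ^ 2 * χ x =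
      ∫ τ in (0 : ℝ)..t, ∫ x,
        χ x * dotR2 (V (τ, x)) (fderiv ℝ V (τ, x) ((1 : ℝ), (0 : ℂ))) := by
  have hVc := hV.continuous
  have hV' : Continuous (fderiv ℝ V) := hV.continuous_fderiv one_ne_zero
  set F : ℝ × ℂ → ℝ := fun q => χ q.2 * dotR2 (V q) (fderiv ℝ V q ((1 : ℝ), (0 : ℂ))) with hF
  have hFc : Continuous F := by fun_prop
  have hFl : LocBdd t F := LocBdd.of_continuous hFc
  have hFz : ∀ τ x, R < ‖x‖ → F (τ, x) = 0 := fun τ x hx => by simp [hF, hz x hx]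
  have hEl : LocBdd t (fun q => 1 / 2 * ‖V q‖ ^ 2 * χ q.2) := LocBdd.of_continuous (by fun_prop)
  have hEz : ∀ τ x, R < ‖x‖ → (1 / 2 * ‖V (τ, x)‖ ^ 2 * χ x) = 0 :=
    fun τ x hx => by simp [hz x hx]
  have hi := hFl.integrable_prod le_rfl hFz
  rw [← integral_sub (hEl.integrable_slice ⟨ht, le_rfl⟩ hEz) (hEl.integrable_slice ⟨le_rfl, ht⟩ hEz)]
  change _ = ∫ τ in (0 : ℝ)..t, ∫ x, F (τ, x)
  rw [intervalIntegral.integral_of_le ht, integral_integral_swap hi]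
  congr 1
  funext x
  rw [← intervalIntegral.integral_of_le ht]
  have hder : ∀ τ ∈ Set.uIcc 0 t,
      HasDerivAt (fun τ => 1 / 2 * ‖V (τ, x)‖ ^ 2 * χ x) (F (τ, x)) τ := by
    intro τ _
    have h1 : HasDerivAt (fun s => V (s, x)) (fderiv ℝ V (τ, x) ((1 : ℝ), (0 : ℂ))) τ := by
      have := ((hV.differentiable one_ne_zero (τ, x)).hasFDerivAt).comp_hasDerivAt τ
        ((hasDerivAt_id τ).prodMk (hasDerivAt_const τ x))
      exact this
    have hre : HasDerivAt (fun y => (V (y, x)).re) _ τ :=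
      Complex.reCLM.hasFDerivAt.comp_hasDerivAt τ h1
    have him : HasDerivAt (fun y => (V (y, x)).im) _ τ :=
      Complex.imCLM.hasFDerivAt.comp_hasDerivAt τ h1
    have := (((hre.mul hre).add (him.mul him)).const_mul (1 / 2)).mul_const (χ x)
    refine (this.congr_deriv ?_).congr_of_eventuallyEq (Eventually.of_forall fun s => ?_)
    · simp [hF, dotR2]
      ring
    · simp [← dotR2_self, dotR2]
  rw [intervalIntegral.integral_eq_sub_of_hasDerivAt hder
    (Continuous.intervalIntegrable (by fun_prop) _ _)]

/-- Relative energy inequality with a spatial cutoff `χ`, given the localized energy inequality of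
the weak solution and the weak formulation tested with `χ • V`. -/
lemma relative_energy_le {T : ℝ} {V : ℝ × ℂ → ℂ} {P : ℝ × ℂ → ℝ}
    (hV : ContDiff ℝ 1 V) (hP : ContDiff ℝ 1 P)
    (hdivfree : ∀ t ∈ Set.Icc (0 : ℝ) T, ∀ x : ℂ, divR2 (fun y => V (t, y)) x = 0)
    (hEuler : ∀ t ∈ Set.Icc (0 : ℝ) T, ∀ x η : ℂ,
      dotR2 η (fderiv ℝ V (t, x) ((1 : ℝ), (0 : ℂ)))
        + dotR2 η (fderiv ℝ V (t, x) ((0 : ℝ), V (t, x)))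
        + fderiv ℝ P (t, x) ((0 : ℝ), η) = 0)
    {v : ℝ → ℂ → ℂ} {p : ℝ → ℂ → ℝ}
    (hv : Measurable (Function.uncurry v)) (hp : Measurable (Function.uncurry p))
    (hb : ∃ Cb : ℝ, ∀ t x, ‖v t x‖ ≤ Cb ∧ |p t x| ≤ Cb)
    (hdivv : ∀ t ∈ Set.Icc (0 : ℝ) T, ∀ ψ : ℂ → ℝ, ContDiff ℝ 1 ψ → HasCompactSupport ψ →
      (∫ x : ℂ, fderiv ℝ ψ x (v t x)) = 0)
    {χ : ℂ → ℝ} (hχ : ContDiff ℝ 1 χ) {R : ℝ} (hz : ∀ x, R < ‖x‖ → χ x = 0)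
    {t : ℝ} (ht : t ∈ Set.Icc 0 T) (h0 : ∀ᵐ x, v 0 x = V (0, x))
    (hA : 0 ≤ (∫ τ in (0 : ℝ)..t, ∫ x,
        (1 / 2 * ‖v τ x‖ ^ 2 + p τ x) * fderiv ℝ χ x (v τ x))
      - (∫ x, 1 / 2 * ‖v t x‖ ^ 2 * χ x) + ∫ x, 1 / 2 * ‖v 0 x‖ ^ 2 * χ x)
    (hB : (∫ τ in (0 : ℝ)..t, ∫ x,
        (χ x * (dotR2 (v τ x) (fderiv ℝ V (τ, x) ((1 : ℝ), (0 : ℂ)))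
            + dotR2 (v τ x) (fderiv ℝ V (τ, x) ((0 : ℝ), v τ x)))
          + dotR2 (v τ x) (V (τ, x)) * fderiv ℝ χ x (v τ x)
          + p τ x * fderiv ℝ χ x (V (τ, x)))) =
      (∫ x, dotR2 (v t x) (V (t, x)) * χ x) - ∫ x, dotR2 (V (0, x)) (V (0, x)) * χ x) :
    1 / 2 * ∫ x, χ x * ‖v t x - V (t, x)‖ ^ 2 ≤
      ∫ τ in (0 : ℝ)..t, ∫ x,
        (-(χ x * dotR2 (v τ x - V (τ, x)) (fderiv ℝ V (τ, x) ((0 : ℝ), v τ x - V (τ, x))))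
          + 1 / 2 * ‖v τ x - V (τ, x)‖ ^ 2 * fderiv ℝ χ x (v τ x)
          + (p τ x - P (τ, x)) * fderiv ℝ χ x (v τ x - V (τ, x))) := by
  have hT : 0 ≤ T := ht.1.trans ht.2
  have hVc := hV.continuous
  have hPc := hP.continuous
  have hχc := hχ.continuous
  have hV' : Continuous (fderiv ℝ V) := hV.continuous_fderiv one_ne_zero
  have hP' : Continuous (fderiv ℝ P) := hP.continuous_fderiv one_ne_zero
  have hχ' : Continuous (fderiv ℝ χ) := hχ.continuous_fderiv one_ne_zero
  have hz' : ∀ x, R < ‖x‖ → fderiv ℝ χ x = 0 := by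
    intro x hx
    have : χ =ᶠ[𝓝 x] fun _ => 0 := by
      filter_upwards [(isOpen_lt continuous_const continuous_norm).mem_nhds hx] with y hy
      exact hz y hy
    rw [this.fderiv_eq]
    simp
  have hcs : ∀ f : ℂ → ℝ, HasCompactSupport (fun x => χ x * f x) := fun f =>
    HasCompactSupport.intro (isCompact_closedBall (0 : ℂ) R) fun x hx => by
      rw [hz x (by simpa using hx), zero_mul]
  have hC := integral_energy_sub hV hχc hz ht.1
  have comp : ∀ {G : (ℝ × ℂ) × ℂ × ℝ → ℝ}, Continuous G →
      LocBdd T (fun q => G (q, v q.1 q.2, p q.1 q.2)) :=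
    fun hG => LocBdd.of_continuous_comp hv hp hb hG
  -- the space-time densities
  have lA : LocBdd T (fun q => (1 / 2 * ‖v q.1 q.2‖ ^ 2 + p q.1 q.2) *
      fderiv ℝ χ q.2 (v q.1 q.2)) :=
    comp (G := fun z => (1 / 2 * ‖z.2.1‖ ^ 2 + z.2.2) * fderiv ℝ χ z.1.2 z.2.1) (by fun_prop)
  have lB : LocBdd T (fun q => χ q.2 * (dotR2 (v q.1 q.2) (fderiv ℝ V q ((1 : ℝ), (0 : ℂ)))
            + dotR2 (v q.1 q.2) (fderiv ℝ V q ((0 : ℝ), v q.1 q.2)))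
          + dotR2 (v q.1 q.2) (V q) * fderiv ℝ χ q.2 (v q.1 q.2)
          + p q.1 q.2 * fderiv ℝ χ q.2 (V q)) :=
    comp (G := fun z => χ z.1.2 * (dotR2 z.2.1 (fderiv ℝ V z.1 ((1 : ℝ), (0 : ℂ)))
            + dotR2 z.2.1 (fderiv ℝ V z.1 ((0 : ℝ), z.2.1)))
          + dotR2 z.2.1 (V z.1) * fderiv ℝ χ z.1.2 z.2.1
          + z.2.2 * fderiv ℝ χ z.1.2 (V z.1)) (by fun_prop)
  have lC : LocBdd T (fun q => χ q.2 * dotR2 (V q) (fderiv ℝ V q ((1 : ℝ), (0 : ℂ)))) :=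
    LocBdd.of_continuous (by fun_prop)
  have lR : LocBdd T (fun q =>
      -(χ q.2 * dotR2 (v q.1 q.2 - V q) (fderiv ℝ V q ((0 : ℝ), v q.1 q.2 - V q)))
          + 1 / 2 * ‖v q.1 q.2 - V q‖ ^ 2 * fderiv ℝ χ q.2 (v q.1 q.2)
          + (p q.1 q.2 - P q) * fderiv ℝ χ q.2 (v q.1 q.2 - V q)) :=
    comp (G := fun z => -(χ z.1.2 * dotR2 (z.2.1 - V z.1)
        (fderiv ℝ V z.1 ((0 : ℝ), z.2.1 - V z.1)))
          + 1 / 2 * ‖z.2.1 - V z.1‖ ^ 2 * fderiv ℝ χ z.1.2 z.2.1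
          + (z.2.2 - P z.1) * fderiv ℝ χ z.1.2 (z.2.1 - V z.1)) (by fun_prop)
  have l1 : LocBdd T (fun q => χ q.2 * dotR2 (V q) (fderiv ℝ V q ((0 : ℝ), v q.1 q.2))
      + 1 / 2 * dotR2 (V q) (V q) * fderiv ℝ χ q.2 (v q.1 q.2)) :=
    comp (G := fun z => χ z.1.2 * dotR2 (V z.1) (fderiv ℝ V z.1 ((0 : ℝ), z.2.1))
      + 1 / 2 * dotR2 (V z.1) (V z.1) * fderiv ℝ χ z.1.2 z.2.1) (by fun_prop)
  have l2 : LocBdd T (fun q => χ q.2 * fderiv ℝ P q ((0 : ℝ), v q.1 q.2)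
      + P q * fderiv ℝ χ q.2 (v q.1 q.2)) :=
    comp (G := fun z => χ z.1.2 * fderiv ℝ P z.1 ((0 : ℝ), z.2.1)
      + P z.1 * fderiv ℝ χ z.1.2 z.2.1) (by fun_prop)
  have l3 : LocBdd T (fun q => χ q.2 * fderiv ℝ P q ((0 : ℝ), V q)
      + P q * fderiv ℝ χ q.2 (V q)) :=
    LocBdd.of_continuous (by fun_prop)
  have zA : ∀ τ x, R < ‖x‖ → (1 / 2 * ‖v τ x‖ ^ 2 + p τ x) * fderiv ℝ χ x (v τ x) = 0 :=
    fun τ x hx => by simp [hz' x hx]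
  have zB : ∀ τ x, R < ‖x‖ → χ x * (dotR2 (v τ x) (fderiv ℝ V (τ, x) ((1 : ℝ), (0 : ℂ)))
            + dotR2 (v τ x) (fderiv ℝ V (τ, x) ((0 : ℝ), v τ x)))
          + dotR2 (v τ x) (V (τ, x)) * fderiv ℝ χ x (v τ x)
          + p τ x * fderiv ℝ χ x (V (τ, x)) = 0 :=
    fun τ x hx => by simp [hz' x hx, hz x hx]
  have zC : ∀ τ x, R < ‖x‖ →
      χ x * dotR2 (V (τ, x)) (fderiv ℝ V (τ, x) ((1 : ℝ), (0 : ℂ))) = 0 :=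
    fun τ x hx => by simp [hz x hx]
  have zR : ∀ τ x, R < ‖x‖ →
      -(χ x * dotR2 (v τ x - V (τ, x)) (fderiv ℝ V (τ, x) ((0 : ℝ), v τ x - V (τ, x))))
          + 1 / 2 * ‖v τ x - V (τ, x)‖ ^ 2 * fderiv ℝ χ x (v τ x)
          + (p τ x - P (τ, x)) * fderiv ℝ χ x (v τ x - V (τ, x)) = 0 :=
    fun τ x hx => by simp [hz' x hx, hz x hx]
  have z1 : ∀ τ x, R < ‖x‖ → χ x * dotR2 (V (τ, x)) (fderiv ℝ V (τ, x) ((0 : ℝ), v τ x))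
      + 1 / 2 * dotR2 (V (τ, x)) (V (τ, x)) * fderiv ℝ χ x (v τ x) = 0 :=
    fun τ x hx => by simp [hz' x hx, hz x hx]
  have z2 : ∀ τ x, R < ‖x‖ → χ x * fderiv ℝ P (τ, x) ((0 : ℝ), v τ x)
      + P (τ, x) * fderiv ℝ χ x (v τ x) = 0 :=
    fun τ x hx => by simp [hz' x hx, hz x hx]
  have z3 : ∀ τ x, R < ‖x‖ → χ x * fderiv ℝ P (τ, x) ((0 : ℝ), V (τ, x))
      + P (τ, x) * fderiv ℝ χ x (V (τ, x)) = 0 :=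
    fun τ x hx => by simp [hz' x hx, hz x hx]
  -- the slicewise identity
  have slice : ∀ τ ∈ Set.Icc 0 T,
      (∫ x, (1 / 2 * ‖v τ x‖ ^ 2 + p τ x) * fderiv ℝ χ x (v τ x))
      - (∫ x, (χ x * (dotR2 (v τ x) (fderiv ℝ V (τ, x) ((1 : ℝ), (0 : ℂ)))
            + dotR2 (v τ x) (fderiv ℝ V (τ, x) ((0 : ℝ), v τ x)))
          + dotR2 (v τ x) (V (τ, x)) * fderiv ℝ χ x (v τ x)
          + p τ x * fderiv ℝ χ x (V (τ, x))))
      + (∫ x, χ x * dotR2 (V (τ, x)) (fderiv ℝ V (τ, x) ((1 : ℝ), (0 : ℂ)))) =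
      ∫ x, (-(χ x * dotR2 (v τ x - V (τ, x)) (fderiv ℝ V (τ, x) ((0 : ℝ), v τ x - V (τ, x))))
          + 1 / 2 * ‖v τ x - V (τ, x)‖ ^ 2 * fderiv ℝ χ x (v τ x)
          + (p τ x - P (τ, x)) * fderiv ℝ χ x (v τ x - V (τ, x))) := by
    intro τ hτ
    have hVs : ContDiff ℝ 1 (fun y => V (τ, y)) := hV.comp (contDiff_prodMk_right τ)
    have hPs : ContDiff ℝ 1 (fun y => P (τ, y)) := hP.comp (contDiff_prodMk_right τ)
    have hVre : ContDiff ℝ 1 (fun y => (V (τ, y)).re) := Complex.reCLM.contDiff.comp hVs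
    have hVim : ContDiff ℝ 1 (fun y => (V (τ, y)).im) := Complex.imCLM.contDiff.comp hVs
    have hK : ContDiff ℝ 1 (fun y => 1 / 2 * dotR2 (V (τ, y)) (V (τ, y))) :=
      contDiff_const.mul ((hVre.mul hVre).add (hVim.mul hVim))
    have dK : ∀ x ξ, fderiv ℝ (fun y => χ y * (1 / 2 * dotR2 (V (τ, y)) (V (τ, y)))) x ξ =
        χ x * dotR2 (V (τ, x)) (fderiv ℝ V (τ, x) ((0 : ℝ), ξ))
          + 1 / 2 * dotR2 (V (τ, x)) (V (τ, x)) * fderiv ℝ χ x ξ := by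
      intro x ξ
      obtain ⟨L, hL, hL'⟩ := hasFDerivAt_dotR2_self (hasFDerivAt_slice hV τ x)
      rw [HasFDerivAt.fderiv (f := fun y => χ y * (1 / 2 * dotR2 (V (τ, y)) (V (τ, y))))
        (((hχ.differentiable one_ne_zero x).hasFDerivAt).mul hL)]
      simp [hL']
    have dP : ∀ x ξ, fderiv ℝ (fun y => χ y * P (τ, y)) x ξ =
        χ x * fderiv ℝ P (τ, x) ((0 : ℝ), ξ) + P (τ, x) * fderiv ℝ χ x ξ := by
      intro x ξ
      rw [HasFDerivAt.fderiv (f := fun y => χ y * P (τ, y))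
        (((hχ.differentiable one_ne_zero x).hasFDerivAt).mul (hasFDerivAt_slice hP τ x))]
      simp
    have e1 := hdivv τ hτ _ (hχ.mul hK) (hcs _)
    have e2 := hdivv τ hτ _ (hχ.mul hPs) (hcs _)
    have e3 := integral_fderiv_apply_eq_zero hVs (hdivfree τ hτ) (hχ.mul hPs) (hcs _)
    simp only [dK] at e1
    simp only [dP] at e2 e3
    have iA := lA.integrable_slice hτ zA
    have iB := lB.integrable_slice hτ zB
    have iC := lC.integrable_slice hτ zC
    have iR := lR.integrable_slice hτ zR
    have i1 := l1.integrable_slice hτ z1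
    have i2 := l2.integrable_slice hτ z2
    have i3 := l3.integrable_slice hτ z3
    have e7 := integral_add (iA.sub iB) iC
    have e8 := integral_sub iA iB
    have e4 := integral_sub ((iR.sub i1).add i2) i3
    have e5 := integral_add (iR.sub i1) i2
    have e6 := integral_sub iR i1
    simp only [Pi.add_apply, Pi.sub_apply] at e4 e5 e6 e7 e8
    rw [e8] at e7
    rw [e1] at e6
    rw [e2, e6] at e5
    rw [e3, e5] at e4
    simp only [sub_zero, add_zero] at e4
    rw [← e4, ← e7]
    congr 1
    funext x
    have hEv := hEuler τ hτ x (v τ x)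
    have hEV := hEuler τ hτ x (V (τ, x))
    have sV : fderiv ℝ V (τ, x) ((0 : ℝ), v τ x - V (τ, x)) =
        fderiv ℝ V (τ, x) ((0 : ℝ), v τ x) - fderiv ℝ V (τ, x) ((0 : ℝ), V (τ, x)) := by
      rw [← map_sub]; simp
    rw [sV, map_sub]
    simp only [← dotR2_self]
    simp only [dotR2, Complex.sub_re, Complex.sub_im] at hEv hEV ⊢
    linear_combination (χ x) * hEV - (χ x) * hEv
  have ii := lA.intervalIntegrable ht.1 ht.2 zA
  have ij := lB.intervalIntegrable ht.1 ht.2 zB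
  have ik := lC.intervalIntegrable ht.1 ht.2 zC
  have htotal := intervalIntegral.integral_add (ii.sub ij) ik
  rw [intervalIntegral.integral_sub ii ij] at htotal
  rw [← intervalIntegral.integral_congr (fun τ hτ => slice τ ?_)]
  swap
  · rw [Set.uIcc_of_le ht.1] at hτ
    exact ⟨hτ.1, hτ.2.trans ht.2⟩
  have lE : LocBdd T (fun q => 1 / 2 * ‖v q.1 q.2‖ ^ 2 * χ q.2) :=
    comp (G := fun z => 1 / 2 * ‖z.2.1‖ ^ 2 * χ z.1.2) (by fun_prop)
  have lF : LocBdd T (fun q => 1 / 2 * ‖V q‖ ^ 2 * χ q.2) :=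
    LocBdd.of_continuous (by fun_prop)
  have lG : LocBdd T (fun q => dotR2 (v q.1 q.2) (V q) * χ q.2) :=
    comp (G := fun z => dotR2 z.2.1 (V z.1) * χ z.1.2) (by fun_prop)
  have iE := lE.integrable_slice (R := R) ht (fun τ x hx => by simp [hz x hx])
  have iF := lF.integrable_slice (R := R) ht (fun τ x hx => by simp [hz x hx])
  have iG := lG.integrable_slice (R := R) ht (fun τ x hx => by simp [hz x hx])
  have final : 1 / 2 * ∫ x, χ x * ‖v t x - V (t, x)‖ ^ 2 =
      (∫ x, 1 / 2 * ‖v t x‖ ^ 2 * χ x) + (∫ x, 1 / 2 * ‖V (t, x)‖ ^ 2 * χ x)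
        - ∫ x, dotR2 (v t x) (V (t, x)) * χ x := by
    have e1 := integral_add iE iF
    have e2 := integral_sub (iE.add iF) iG
    simp only [Pi.add_apply] at e1 e2
    rw [e1] at e2
    rw [← e2, ← integral_const_mul]
    congr 1
    funext x
    simp only [← dotR2_self]
    simp only [dotR2, Complex.sub_re, Complex.sub_im]
    ring
  have init : ∫ x, 1 / 2 * ‖v 0 x‖ ^ 2 * χ x = ∫ x, 1 / 2 * ‖V (0, x)‖ ^ 2 * χ x :=
    integral_congr_ae (by filter_upwards [h0] with x hx; rw [hx])
  have init2 : ∫ x, dotR2 (V (0, x)) (V (0, x)) * χ x = 2 * ∫ x, 1 / 2 * ‖V (0, x)‖ ^ 2 * χ x := by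
    rw [← integral_const_mul]
    congr 1
    funext x
    rw [dotR2_self]
    ring
  rw [htotal, final]
  linarith

lemma exists_time_cutoff {ρ : ℝ} (hρ : 0 < ρ) : ∃ θ : ℝ → ℝ, ContDiff ℝ 1 θ ∧
    HasCompactSupport θ ∧ (∀ s, 0 ≤ θ s ∧ θ s ≤ 1) ∧ ∀ s, |s| < ρ → θ s = 1 := by
  let f : ContDiffBump (0 : ℝ) := ⟨ρ, ρ + 1, hρ, by linarith⟩
  refine ⟨f, f.contDiff, f.hasCompactSupport, fun s => ⟨f.nonneg, f.le_one⟩, fun s hs => ?_⟩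
  exact f.one_of_mem_closedBall (by simpa [f] using hs.le)

section
variable {θ : ℝ → ℝ} {χ : ℂ → ℝ} {ρ : ℝ}

lemma hasCompactSupport_mul_prod (hθ : HasCompactSupport θ) (hχ : HasCompactSupport χ) :
    HasCompactSupport (fun q : ℝ × ℂ => θ q.1 * χ q.2) := by
  refine HasCompactSupport.intro (hθ.isCompact.prod hχ.isCompact) fun q hq => ?_
  by_contra h
  exact hq ⟨subset_tsupport _ (left_ne_zero_of_mul h), subset_tsupport _ (right_ne_zero_of_mul h)⟩

lemma hasFDerivAt_cutoff (hχ : ContDiff ℝ 1 χ) (hθ1 : ∀ s, |s| < ρ → θ s = 1) {τ : ℝ}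
    (hτ : |τ| < ρ) (x : ℂ) :
    HasFDerivAt (fun q : ℝ × ℂ => θ q.1 * χ q.2)
      ((fderiv ℝ χ x).comp (ContinuousLinearMap.snd ℝ ℝ ℂ)) (τ, x) := by
  have h : HasFDerivAt (fun q : ℝ × ℂ => χ q.2)
      ((fderiv ℝ χ x).comp (ContinuousLinearMap.snd ℝ ℝ ℂ)) (τ, x) :=
    HasFDerivAt.comp (τ, x) (g := χ) ((hχ.differentiable one_ne_zero x).hasFDerivAt) hasFDerivAt_snd
  refine h.congr_of_eventuallyEq ?_
  have : ∀ᶠ q : ℝ × ℂ in 𝓝 (τ, x), |q.1| < ρ :=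
    (isOpen_lt (by fun_prop) continuous_const).mem_nhds hτ
  filter_upwards [this] with q hq
  rw [hθ1 _ hq, one_mul]

lemma dissipationPairing_cutoff (hχ : ContDiff ℝ 1 χ) (hθ1 : ∀ s, |s| < ρ → θ s = 1)
    (v : ℝ → ℂ → ℂ) (p : ℝ → ℂ → ℝ) {t : ℝ} (ht : 0 ≤ t) (htρ : t < ρ) :
    dissipationPairing v p t (fun q => θ q.1 * χ q.2) =
      (∫ τ in (0 : ℝ)..t, ∫ x, (1 / 2 * ‖v τ x‖ ^ 2 + p τ x) * fderiv ℝ χ x (v τ x))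
      - (∫ x, 1 / 2 * ‖v t x‖ ^ 2 * χ x) + ∫ x, 1 / 2 * ‖v 0 x‖ ^ 2 * χ x := by
  unfold dissipationPairing
  simp only [hθ1 t (by rwa [abs_of_nonneg ht]), hθ1 0 (by rw [abs_zero]; linarith), one_mul]
  congr 2
  refine intervalIntegral.integral_congr fun τ hτ => ?_
  rw [Set.uIcc_of_le ht] at hτ
  refine integral_congr_ae (Eventually.of_forall fun x => ?_)
  have h := (hasFDerivAt_cutoff hχ hθ1 (τ := τ)
    (by rw [abs_of_nonneg hτ.1]; exact hτ.2.trans_lt htρ) x).fderiv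
  simp only [h]
  simp

lemma fderiv_cutoff_smul (hχ : ContDiff ℝ 1 χ) (hθ1 : ∀ s, |s| < ρ → θ s = 1) {τ : ℝ}
    (hτ : |τ| < ρ) (x : ℂ) {V : ℝ × ℂ → ℂ} (hV : ContDiff ℝ 1 V) (ζ : ℝ × ℂ) :
    fderiv ℝ (fun q : ℝ × ℂ => (θ q.1 * χ q.2) • V q) (τ, x) ζ =
      χ x • fderiv ℝ V (τ, x) ζ + fderiv ℝ χ x ζ.2 • V (τ, x) := by
  have h := (hasFDerivAt_cutoff hχ hθ1 hτ x).smul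
    (hV.differentiable one_ne_zero (τ, x)).hasFDerivAt
  have h' := h.fderiv
  rw [show (fun q : ℝ × ℂ => (θ q.1 * χ q.2) • V q) =
    (fun q : ℝ × ℂ => θ q.1 * χ q.2) • V from rfl, h']
  simp [hθ1 _ hτ]

lemma weak_cutoff (hχ : ContDiff ℝ 1 χ) (hθ1 : ∀ s, |s| < ρ → θ s = 1) {V : ℝ × ℂ → ℂ}
    (hV : ContDiff ℝ 1 V) {T : ℝ}
    (hdivfree : ∀ t ∈ Set.Icc (0 : ℝ) T, ∀ x : ℂ, divR2 (fun y => V (t, y)) x = 0)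
    {v : ℝ → ℂ → ℂ} {p : ℝ → ℂ → ℝ} {t : ℝ} (ht : t ∈ Set.Icc 0 T) (htρ : t < ρ)
    (hw : (∫ τ in (0 : ℝ)..t, ∫ x : ℂ,
          (dotR2 (v τ x) (fderiv ℝ (fun q : ℝ × ℂ => (θ q.1 * χ q.2) • V q) (τ, x)
              ((1 : ℝ), (0 : ℂ)))
            + dotR2 (v τ x) (fderiv ℝ (fun q : ℝ × ℂ => (θ q.1 * χ q.2) • V q) (τ, x)
              ((0 : ℝ), v τ x))
            + p τ x * spaceDiv (fun q : ℝ × ℂ => (θ q.1 * χ q.2) • V q) (τ, x))) =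
        (∫ x : ℂ, dotR2 (v t x) ((θ t * χ x) • V (t, x)))
          - ∫ x : ℂ, dotR2 (V (0, x)) ((θ 0 * χ x) • V (0, x))) :
    (∫ τ in (0 : ℝ)..t, ∫ x,
        (χ x * (dotR2 (v τ x) (fderiv ℝ V (τ, x) ((1 : ℝ), (0 : ℂ)))
            + dotR2 (v τ x) (fderiv ℝ V (τ, x) ((0 : ℝ), v τ x)))
          + dotR2 (v τ x) (V (τ, x)) * fderiv ℝ χ x (v τ x)
          + p τ x * fderiv ℝ χ x (V (τ, x)))) =
      (∫ x, dotR2 (v t x) (V (t, x)) * χ x) - ∫ x, dotR2 (V (0, x)) (V (0, x)) * χ x := by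
  have hsmul : ∀ (a : ℝ) (z w : ℂ), dotR2 z (a • w) = dotR2 z w * a := by
    intro a z w
    simp only [dotR2, Complex.real_smul, Complex.re_ofReal_mul, Complex.im_ofReal_mul]
    ring
  rw [hθ1 t (by rw [abs_of_nonneg ht.1]; exact htρ),
    hθ1 0 (by rw [abs_zero]; exact ht.1.trans_lt htρ)] at hw
  simp only [one_mul, hsmul] at hw
  rw [← hw]
  refine intervalIntegral.integral_congr fun τ hτ => ?_
  rw [Set.uIcc_of_le ht.1] at hτ
  have hτρ : |τ| < ρ := by rw [abs_of_nonneg hτ.1]; exact hτ.2.trans_lt htρ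
  refine integral_congr_ae (Eventually.of_forall fun x => ?_)
  have hd := hdivfree τ ⟨hτ.1, hτ.2.trans ht.2⟩ x
  simp only [divR2, fderiv_slice_apply hV] at hd
  simp only [spaceDiv, fderiv_cutoff_smul hχ hθ1 hτρ x hV, map_zero, zero_smul, add_zero]
  rw [clm_apply_eq_re_im (fderiv ℝ χ x) (V (τ, x))]
  simp only [dotR2, Complex.real_smul, Complex.re_ofReal_mul, Complex.im_ofReal_mul,
    Complex.add_re, Complex.add_im, smul_eq_mul]
  linear_combination (-p τ x * χ x) * hd

end

/-- The weak formulation at time zero identifies the initial datum. -/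
lemma initial_ae_eq {v₀ V₀ : ℂ → ℂ} (hv : Measurable v₀) (hb : ∃ C, ∀ x, ‖v₀ x‖ ≤ C)
    (hV : Continuous V₀)
    (h : ∀ Ψ : ℝ × ℂ → ℂ, ContDiff ℝ 1 Ψ → HasCompactSupport Ψ →
      0 = (∫ x : ℂ, dotR2 (v₀ x) (Ψ (0, x))) - ∫ x : ℂ, dotR2 (V₀ x) (Ψ (0, x))) :
    ∀ᵐ x, v₀ x = V₀ x := by
  obtain ⟨C, hC⟩ := hb
  obtain ⟨θ, hθ, hθc, -, hθ1⟩ := exists_time_cutoff (ρ := 1) one_pos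
  have key : ∀ e : ℂ, ∀ᵐ x, dotR2 (v₀ x) e = dotR2 (V₀ x) e := by
    intro e
    have hm : Measurable fun x => dotR2 (v₀ x) e := by unfold dotR2; fun_prop
    have hc : Continuous fun x => dotR2 (V₀ x) e := by unfold dotR2; fun_prop
    have hbd : ∀ x, ‖dotR2 (v₀ x) e‖ ≤ 2 * C * ‖e‖ := by
      intro x
      have h1 := Complex.abs_re_le_norm (v₀ x)
      have h2 := Complex.abs_im_le_norm (v₀ x)
      have h3 := Complex.abs_re_le_norm e
      have h4 := Complex.abs_im_le_norm e
      have h5 := hC x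
      rw [dotR2, Real.norm_eq_abs]
      refine (abs_add_le _ _).trans ?_
      rw [abs_mul, abs_mul]
      have h6 := mul_le_mul (h1.trans h5) h3 (abs_nonneg _) ((norm_nonneg _).trans h5)
      have h7 := mul_le_mul (h2.trans h5) h4 (abs_nonneg _) ((norm_nonneg _).trans h5)
      linarith
    have hli : LocallyIntegrable fun x => dotR2 (v₀ x) e :=
      (memLp_top_of_bound hm.aestronglyMeasurable _ (Eventually.of_forall hbd)).locallyIntegrable
        le_top
    refine ae_eq_of_integral_contDiff_smul_eq hli hc.locallyIntegrable fun g hg hgc => ?_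
    have hg1 : ContDiff ℝ 1 g := hg.of_le (by exact_mod_cast le_top)
    have hΨ := h (fun q => (θ q.1 * g q.2) • e)
      (by fun_prop) ((hasCompactSupport_mul_prod hθc hgc).smul_right)
    have hsmul : ∀ (a : ℝ) (z w : ℂ), dotR2 z (a • w) = a • dotR2 z w := by
      intro a z w
      simp only [dotR2, Complex.real_smul, Complex.re_ofReal_mul, Complex.im_ofReal_mul,
        smul_eq_mul]
      ring
    simp only [hθ1 0 (by simp), one_mul, hsmul] at hΨ
    linarith
  filter_upwards [key 1, key Complex.I] with x h1 h2
  simp only [dotR2, Complex.one_re, Complex.one_im, Complex.I_re, Complex.I_im] at h1 h2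
  exact Complex.ext (by linarith) (by linarith)

lemma neg_dotR2_fderiv_le {V : ℝ × ℂ → ℂ} (hV : ContDiff ℝ 1 V) {t c : ℝ} {x : ℂ}
    (hsym : ∀ ξ : ℂ, ‖ξ‖ = 1 → -dotR2 (fderiv ℝ (fun y => V (t, y)) x ξ) ξ ≤ c) (w : ℂ) :
    -dotR2 w (fderiv ℝ V (t, x) ((0 : ℝ), w)) ≤ c * ‖w‖ ^ 2 := by
  rcases eq_or_ne w 0 with rfl | hw
  · simp [dotR2]
  have hn : ‖w‖ ≠ 0 := norm_ne_zero_iff.2 hw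
  have h := hsym (‖w‖⁻¹ • w) (by rw [norm_smul, norm_inv, norm_norm, inv_mul_cancel₀ hn])
  rw [map_smul, fderiv_slice_apply hV] at h
  have h' := mul_le_mul_of_nonneg_right h (sq_nonneg ‖w‖)
  refine le_trans (le_of_eq ?_) h'
  simp only [dotR2, Complex.real_smul, Complex.re_ofReal_mul, Complex.im_ofReal_mul]
  field_simp

lemma nonneg_of_neg_sym_le {u : ℂ → ℂ} {c : ℝ} {x : ℂ} (hdiv : divR2 u x = 0)
    (hsym : ∀ ξ : ℂ, ‖ξ‖ = 1 → -dotR2 (fderiv ℝ u x ξ) ξ ≤ c) : 0 ≤ c := by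
  have h1 := hsym 1 (by simp)
  have h2 := hsym Complex.I (by simp)
  simp only [dotR2, Complex.one_re, Complex.one_im, Complex.I_re, Complex.I_im] at h1 h2
  unfold divR2 at hdiv
  linarith

lemma LocBdd.intervalIntegrable_mul {T R : ℝ} (hT : 0 ≤ T) {F : ℝ × ℂ → ℝ} (hF : LocBdd T F)
    (hz : ∀ τ x, R < ‖x‖ → F (τ, x) = 0) {k : ℝ → ℝ} (hk : IntervalIntegrable k volume 0 T) :
    IntervalIntegrable (fun τ => k τ * ∫ x, F (τ, x)) volume 0 T := by
  obtain ⟨C, hC⟩ := hF.exists_bound_integral hz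
  have h := hF.intervalIntegrable hT le_rfl hz
  rw [intervalIntegrable_iff_integrableOn_Ioc_of_le hT] at hk h ⊢
  refine Integrable.mul_bdd (c := C) hk h.aestronglyMeasurable ?_
  filter_upwards [ae_restrict_mem measurableSet_Ioc] with τ hτ
  exact hC τ ⟨hτ.1.le, hτ.2⟩

lemma integral_flux_le {T : ℝ} {V : ℝ × ℂ → ℂ} {P : ℝ × ℂ → ℝ}
    (hV : ContDiff ℝ 1 V) (hP : ContDiff ℝ 1 P) {g : ℝ → ℝ} (hg : IntervalIntegrable g volume 0 T)
    (hsym : ∀ t ∈ Set.Icc (0 : ℝ) T, ∀ x w : ℂ,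
      -dotR2 w (fderiv ℝ V (t, x) ((0 : ℝ), w)) ≤ g t * ‖w‖ ^ 2)
    {v : ℝ → ℂ → ℂ} {p : ℝ → ℂ → ℝ}
    (hv : Measurable (Function.uncurry v)) (hp : Measurable (Function.uncurry p))
    {B : ℝ} (hb : ∀ t x, ‖v t x‖ ≤ B ∧ |p t x| ≤ B)
    {χ : ℂ → ℝ} (hχ : ContDiff ℝ 1 χ) (hχ0 : ∀ x, 0 ≤ χ x) {S : Set ℂ} (hS : MeasurableSet S)
    {R : ℝ} (hSR : S ⊆ Metric.closedBall 0 R)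
    (hz : ∀ x, R < ‖x‖ → χ x = 0) {C : ℝ} (hC : ∀ x, ‖fderiv ℝ χ x‖ ≤ C)
    (hχS : ∀ x, x ∉ S → fderiv ℝ χ x = 0) {t : ℝ} (ht : t ∈ Set.Icc 0 T) :
    (∫ τ in (0 : ℝ)..t, ∫ x,
        (-(χ x * dotR2 (v τ x - V (τ, x)) (fderiv ℝ V (τ, x) ((0 : ℝ), v τ x - V (τ, x))))
          + 1 / 2 * ‖v τ x - V (τ, x)‖ ^ 2 * fderiv ℝ χ x (v τ x)
          + (p τ x - P (τ, x)) * fderiv ℝ χ x (v τ x - V (τ, x)))) ≤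
      (∫ τ in (0 : ℝ)..t, g τ * ∫ x, χ x * ‖v τ x - V (τ, x)‖ ^ 2)
        + C * (B + 1) * ((∫ τ in (0 : ℝ)..T, ∫ x in S, ‖v τ x - V (τ, x)‖ ^ 2)
          + ∫ τ in (0 : ℝ)..T, ∫ x in S, ‖v τ x - V (τ, x)‖ * |p τ x - P (τ, x)|) := by
  have hT : 0 ≤ T := ht.1.trans ht.2
  have hVc := hV.continuous
  have hPc := hP.continuous
  have hχc := hχ.continuous
  have hV' : Continuous (fderiv ℝ V) := hV.continuous_fderiv one_ne_zero
  have hχ' : Continuous (fderiv ℝ χ) := hχ.continuous_fderiv one_ne_zero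
  have hB0 : 0 ≤ B := (norm_nonneg _).trans (hb 0 0).1
  have hC0 : 0 ≤ C := (norm_nonneg _).trans (hC 0)
  have hCB : 0 ≤ C * (B + 1) := by positivity
  have comp : ∀ {G : (ℝ × ℂ) × ℂ × ℝ → ℝ}, Continuous G →
      LocBdd T (fun q => G (q, v q.1 q.2, p q.1 q.2)) :=
    fun hG => LocBdd.of_continuous_comp hv hp ⟨B, hb⟩ hG
  have hz' : ∀ x, R < ‖x‖ → fderiv ℝ χ x = 0 := fun x hx => hχS x fun hxS =>
    absurd (hSR hxS) (by simpa using hx)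
  have lF : LocBdd T (fun q =>
      -(χ q.2 * dotR2 (v q.1 q.2 - V q) (fderiv ℝ V q ((0 : ℝ), v q.1 q.2 - V q)))
        + 1 / 2 * ‖v q.1 q.2 - V q‖ ^ 2 * fderiv ℝ χ q.2 (v q.1 q.2)
        + (p q.1 q.2 - P q) * fderiv ℝ χ q.2 (v q.1 q.2 - V q)) :=
    comp (G := fun z =>
      -(χ z.1.2 * dotR2 (z.2.1 - V z.1) (fderiv ℝ V z.1 ((0 : ℝ), z.2.1 - V z.1)))
        + 1 / 2 * ‖z.2.1 - V z.1‖ ^ 2 * fderiv ℝ χ z.1.2 z.2.1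
        + (z.2.2 - P z.1) * fderiv ℝ χ z.1.2 (z.2.1 - V z.1)) (by fun_prop)
  have lY : LocBdd T (fun q => χ q.2 * ‖v q.1 q.2 - V q‖ ^ 2) :=
    comp (G := fun z => χ z.1.2 * ‖z.2.1 - V z.1‖ ^ 2) (by fun_prop)
  have lA : LocBdd T (fun q => ‖v q.1 q.2 - V q‖ ^ 2) :=
    comp (G := fun z => ‖z.2.1 - V z.1‖ ^ 2) (by fun_prop)
  have lB : LocBdd T (fun q => ‖v q.1 q.2 - V q‖ * |p q.1 q.2 - P q|) :=
    comp (G := fun z => ‖z.2.1 - V z.1‖ * |z.2.2 - P z.1|) (by fun_prop)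
  have zF : ∀ (τ : ℝ) (x : ℂ), R < ‖x‖ → (fun q : ℝ × ℂ =>
      -(χ q.2 * dotR2 (v q.1 q.2 - V q) (fderiv ℝ V q ((0 : ℝ), v q.1 q.2 - V q)))
        + 1 / 2 * ‖v q.1 q.2 - V q‖ ^ 2 * fderiv ℝ χ q.2 (v q.1 q.2)
        + (p q.1 q.2 - P q) * fderiv ℝ χ q.2 (v q.1 q.2 - V q)) (τ, x) = 0 :=
    fun τ x hx => by simp [hz x hx, hz' x hx]
  have zY : ∀ (τ : ℝ) (x : ℂ), R < ‖x‖ →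
      (fun q : ℝ × ℂ => χ q.2 * ‖v q.1 q.2 - V q‖ ^ 2) (τ, x) = 0 :=
    fun τ x hx => by simp [hz x hx]
  have slice : ∀ τ ∈ Set.Icc 0 T, (∫ x,
        (-(χ x * dotR2 (v τ x - V (τ, x)) (fderiv ℝ V (τ, x) ((0 : ℝ), v τ x - V (τ, x))))
          + 1 / 2 * ‖v τ x - V (τ, x)‖ ^ 2 * fderiv ℝ χ x (v τ x)
          + (p τ x - P (τ, x)) * fderiv ℝ χ x (v τ x - V (τ, x)))) ≤
      g τ * (∫ x, χ x * ‖v τ x - V (τ, x)‖ ^ 2)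
        + C * (B + 1) * ((∫ x in S, ‖v τ x - V (τ, x)‖ ^ 2)
          + ∫ x in S, ‖v τ x - V (τ, x)‖ * |p τ x - P (τ, x)|) := by
    intro τ hτ
    have iF := lF.integrable_slice hτ zF
    have iY := lY.integrable_slice hτ zY
    have iA := lA.integrableOn_slice hτ hSR hS
    have iB := lB.integrableOn_slice hτ hSR hS
    have iI : IntegrableOn (fun x => C * (B + 1) *
        (‖v τ x - V (τ, x)‖ ^ 2 + ‖v τ x - V (τ, x)‖ * |p τ x - P (τ, x)|)) S :=
      Integrable.const_mul (Integrable.add iA iB) _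
    rw [← integral_add iA iB, ← integral_const_mul, ← integral_const_mul, ← integral_indicator hS,
      ← integral_add (iY.const_mul _) (iI.integrable_indicator hS)]
    refine integral_mono iF
      ((iY.const_mul _).add (iI.integrable_indicator hS)) fun x => ?_
    have h1 := mul_le_mul_of_nonneg_left (hsym τ hτ x (v τ x - V (τ, x))) (hχ0 x)
    by_cases hx : x ∈ S
    · simp only [Set.indicator_of_mem hx]
      have h2 : fderiv ℝ χ x (v τ x) ≤ C * B :=
        (le_abs_self _).trans ((fderiv ℝ χ x).le_of_opNorm_le_of_le (hC x) (hb τ x).1)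
      have h3 : |fderiv ℝ χ x (v τ x - V (τ, x))| ≤ C * ‖v τ x - V (τ, x)‖ :=
        (fderiv ℝ χ x).le_of_opNorm_le (hC x) _
      have h4 := mul_le_mul_of_nonneg_left h2
        (by positivity : 0 ≤ 1 / 2 * ‖v τ x - V (τ, x)‖ ^ 2)
      have h5 : (p τ x - P (τ, x)) * fderiv ℝ χ x (v τ x - V (τ, x)) ≤
          |p τ x - P (τ, x)| * (C * ‖v τ x - V (τ, x)‖) := by
        refine (le_abs_self _).trans ?_
        rw [abs_mul]
        exact mul_le_mul_of_nonneg_left h3 (abs_nonneg _)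
      have h6 : 0 ≤ C * B * ‖v τ x - V (τ, x)‖ ^ 2 := by positivity
      have h7 : 0 ≤ C * ‖v τ x - V (τ, x)‖ ^ 2 := by positivity
      have h8 : 0 ≤ C * B * (‖v τ x - V (τ, x)‖ * |p τ x - P (τ, x)|) := by positivity
      nlinarith
    · simp only [Set.indicator_of_notMem hx, hχS x hx, zero_apply]
      linarith
  have hsub : Set.uIcc 0 t ⊆ Set.uIcc 0 T := by
    rw [Set.uIcc_of_le ht.1, Set.uIcc_of_le hT]
    exact Set.Icc_subset_Icc_right ht.2
  have jA := lA.intervalIntegrable_restrict hT le_rfl hSR hS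
  have jB := lB.intervalIntegrable_restrict hT le_rfl hSR hS
  have jA' := lA.intervalIntegrable_restrict ht.1 ht.2 hSR hS
  have jB' := lB.intervalIntegrable_restrict ht.1 ht.2 hSR hS
  have jY := (lY.intervalIntegrable_mul hT zY hg).mono_set hsub
  have mono := intervalIntegral.integral_mono_on ht.1 (lF.intervalIntegrable ht.1 ht.2 zF)
    (jY.add ((jA'.add jB').const_mul (C * (B + 1))))
    fun τ hτ => slice τ ⟨hτ.1, hτ.2.trans ht.2⟩
  refine mono.trans ?_
  rw [intervalIntegral.integral_add jY ((jA'.add jB').const_mul _),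
    intervalIntegral.integral_const_mul, intervalIntegral.integral_add jA' jB']
  gcongr
  · refine intervalIntegral.integral_mono_interval le_rfl ht.1 ht.2
      (Eventually.of_forall fun τ => ?_) jA
    exact integral_nonneg fun x => by positivity
  · refine intervalIntegral.integral_mono_interval le_rfl ht.1 ht.2
      (Eventually.of_forall fun τ => ?_) jB
    exact integral_nonneg fun x => by positivity

/-- If the local `L²` integrals against cutoffs that are eventually `1` on every ball tend to zero,
the function vanishes almost everywhere. -/
lemma ae_eq_zero_of_tendsto_cutoff {w : ℂ → ℂ} {χ : ℕ → ℂ → ℝ}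
    (hχ0 : ∀ M x, 0 ≤ χ M x) (hχ1 : ∀ (M : ℕ) x, ‖x‖ ≤ (M : ℝ) → χ M x = 1)
    (hi : ∀ M, Integrable fun x => χ M x * ‖w x‖ ^ 2)
    (h : Tendsto (fun M => ∫ x, χ M x * ‖w x‖ ^ 2) atTop (𝓝 0)) : ∀ᵐ x, w x = 0 := by
  have hball : ∀ N : ℕ, ∀ᵐ x, ‖x‖ ≤ (N : ℝ) → w x = 0 := by
    intro N
    have hS : MeasurableSet (Metric.closedBall (0 : ℂ) N) := measurableSet_closedBall
    have heq : ∀ M, N ≤ M → Set.EqOn (fun x => χ M x * ‖w x‖ ^ 2) (fun x => ‖w x‖ ^ 2)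
        (Metric.closedBall (0 : ℂ) N) := by
      intro M hM x hx
      have : ‖x‖ ≤ (M : ℝ) := (mem_closedBall_zero_iff.1 hx).trans (by exact_mod_cast hM)
      change χ M x * ‖w x‖ ^ 2 = ‖w x‖ ^ 2
      rw [hχ1 M x this, one_mul]
    have hint : IntegrableOn (fun x => ‖w x‖ ^ 2) (Metric.closedBall (0 : ℂ) N) :=
      (hi N).integrableOn.congr_fun (heq N le_rfl) hS
    have hle : ∫ x in Metric.closedBall (0 : ℂ) N, ‖w x‖ ^ 2 ≤ 0 := by
      refine ge_of_tendsto h ((eventually_ge_atTop N).mono fun M hM => ?_)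
      rw [← setIntegral_congr_fun hS (heq M hM)]
      exact setIntegral_le_integral (hi M)
        (Eventually.of_forall fun x => mul_nonneg (hχ0 M x) (sq_nonneg _))
    have hzero := le_antisymm hle (integral_nonneg fun x => sq_nonneg ‖w x‖)
    rw [integral_eq_zero_iff_of_nonneg (fun x => sq_nonneg ‖w x‖) hint] at hzero
    filter_upwards [(ae_restrict_iff' hS).1 hzero] with x hx hxN
    simpa using hx (mem_closedBall_zero_iff.2 hxN)
  filter_upwards [ae_all_iff.2 hball] with x hx
  obtain ⟨N, hN⟩ := exists_nat_ge ‖x‖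
  exact hx N hN

/-- Weak–strong uniqueness with possibly infinite energy: a bounded admissible
weak solution `(v, p)` starting from the initial datum of a bounded `C¹`
solution `(𝐕, P)` with `(∇_sym 𝐕)⁻ ∈ L¹_t L^∞_x`, and satisfying the stated
annulus decay conditions, coincides with it a.e. on `[0,T] × ℝ²`. -/
theorem stmt_1 (T : ℝ) (hT : 0 < T)
    (V : ℝ × ℂ → ℂ) (P : ℝ × ℂ → ℝ)
    (hV : ContDiff ℝ 1 V) (hP : ContDiff ℝ 1 P)
    (hVbdd : ∃ Cb : ℝ, ∀ q : ℝ × ℂ, ‖V q‖ ≤ Cb ∧ |P q| ≤ Cb)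
    -- pointwise Euler: ∂_t 𝐯 + div(𝐯⊗𝐯) + ∇𝐩 = 0 and div 𝐯 = 0 on [0,T] × ℝ²
    (hdivfree : ∀ t ∈ Set.Icc (0 : ℝ) T, ∀ x : ℂ, divR2 (fun y => V (t, y)) x = 0)
    (hEuler : ∀ t ∈ Set.Icc (0 : ℝ) T, ∀ x : ℂ,
      fderiv ℝ V (t, x) ((1 : ℝ), (0 : ℂ))
        + (((divR2 (fun y => (V (t, y)).re • V (t, y)) x : ℝ) : ℂ)
            + ((divR2 (fun y => (V (t, y)).im • V (t, y)) x : ℝ) : ℂ) * Complex.I)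
        + (((fderiv ℝ (fun y => P (t, y)) x 1 : ℝ) : ℂ)
            + ((fderiv ℝ (fun y => P (t, y)) x Complex.I : ℝ) : ℂ) * Complex.I) = 0)
    -- ∫₀ᵀ ‖(∇_sym 𝐯(τ))⁻‖_{L^∞} dτ < ∞ :
    -- the negative part of the symmetric gradient is dominated on [0,T] by an
    -- integrable function g, uniformly in x and in unit directions ξ
    (g : ℝ → ℝ) (hg : IntegrableOn g (Set.Icc (0 : ℝ) T))
    (hsym : ∀ t ∈ Set.Icc (0 : ℝ) T, ∀ x : ℂ, ∀ ξ : ℂ, ‖ξ‖ = 1 →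
      -dotR2 (fderiv ℝ (fun y => V (t, y)) x ξ) ξ ≤ g t)
    -- the weak solution, with the same initial datum
    (v : ℝ → ℂ → ℂ) (p : ℝ → ℂ → ℝ)
    (hweak : IsWeakEulerSolution T v p (fun x => V (0, x)))
    -- admissibility of the dissipation
    (hadm : ∃ K : Set (ℝ × ℂ), IsCompact K ∧
      ∀ t ∈ Set.Icc (0 : ℝ) T, ∀ ψ : ℝ × ℂ → ℝ, ContDiff ℝ 1 ψ → HasCompactSupport ψ →
        (∀ q, 0 ≤ ψ q ∧ ψ q ≤ 1) →
        (∃ U : Set (ℝ × ℂ), IsOpen U ∧ K ⊆ U ∧ ∀ q ∈ U, ψ q = 1) →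
        0 ≤ dissipationPairing v p t ψ)
    -- decay conditions on annuli
    (hdecay2 : ∀ t ∈ Set.Icc (0 : ℝ) T,
      Tendsto (fun M : ℕ => ∫ τ in (0:ℝ)..t,
          ∫ x in Metric.ball (0 : ℂ) (M + 1) \ Metric.ball (0 : ℂ) M, ‖v τ x - V (τ, x)‖ ^ 2)
        atTop (nhds 0))
    (hdecay11 : ∀ t ∈ Set.Icc (0 : ℝ) T,
      Tendsto (fun M : ℕ => ∫ τ in (0:ℝ)..t,
          ∫ x in Metric.ball (0 : ℂ) (M + 1) \ Metric.ball (0 : ℂ) M,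
            ‖v τ x - V (τ, x)‖ * |p τ x - P (τ, x)|)
        atTop (nhds 0)) :
    ∀ᵐ q : ℝ × ℂ ∂(volume.restrict (Set.Icc (0 : ℝ) T ×ˢ (Set.univ : Set ℂ))),
      v q.1 q.2 = V q := by
  obtain ⟨hv, hp, ⟨B, hb⟩, hdivv, hw, -⟩ := hweak
  obtain ⟨K, hK, hadm⟩ := hadm
  obtain ⟨C, -, hcut⟩ := exists_cutoff
  choose χ hχ hχ01 hχ1 hχ0 hχC hχS using hcut
  have hVc := hV.continuous
  have hg' : IntervalIntegrable g volume 0 T :=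
    (intervalIntegrable_iff_integrableOn_Icc_of_le hT.le).2 hg
  have hsym' : ∀ t ∈ Set.Icc (0 : ℝ) T, ∀ x w : ℂ,
      -dotR2 w (fderiv ℝ V (t, x) ((0 : ℝ), w)) ≤ g t * ‖w‖ ^ 2 :=
    fun t ht x => neg_dotR2_fderiv_le hV (hsym t ht x)
  have hg0 : ∀ t ∈ Set.Icc 0 T, 0 ≤ g t :=
    fun t ht => nonneg_of_neg_sym_le (hdivfree t ht 0) (hsym t ht 0)
  have hz : ∀ (M : ℕ) (x : ℂ), (M + 1 : ℝ) < ‖x‖ → χ M x = 0 := fun M x hx => hχ0 M x hx.le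
  have hχc : ∀ M, HasCompactSupport (χ M) := fun M =>
    HasCompactSupport.intro (isCompact_closedBall (0 : ℂ) (M + 1)) fun x hx =>
      hz M x (by simpa using hx)
  have h0 : ∀ᵐ x, v 0 x = V (0, x) := by
    refine initial_ae_eq (V₀ := fun x => V (0, x)) (hv.comp measurable_prodMk_left)
      ⟨B, fun x => (hb 0 x).1⟩ (by fun_prop) fun Ψ hΨ hΨc => ?_
    have h := hw Ψ hΨ hΨc 0 ⟨le_rfl, hT.le⟩
    rwa [intervalIntegral.integral_same] at h
  obtain ⟨ρ₀, hρ₀⟩ := hK.isBounded.subset_closedBall (0 : ℝ × ℂ)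
  obtain ⟨θ, hθ, hθc, hθ01, hθ1⟩ := exists_time_cutoff (ρ := max ρ₀ T + 1)
    (by linarith [le_max_right ρ₀ T])
  have hTρ : ∀ t ∈ Set.Icc 0 T, t < max ρ₀ T + 1 := fun t ht => by
    linarith [le_max_right ρ₀ T, ht.2]
  set A : ℕ → Set ℂ := fun M => Metric.ball (0 : ℂ) (M + 1) \ Metric.ball (0 : ℂ) M
  have hAm : ∀ M, MeasurableSet (A M) := fun M => measurableSet_ball.diff measurableSet_ball
  have hAR : ∀ M : ℕ, A M ⊆ Metric.closedBall 0 (M + 1) :=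
    fun M => Set.sdiff_subset.trans Metric.ball_subset_closedBall
  have lY : ∀ M, LocBdd T (fun q => χ M q.2 * ‖v q.1 q.2 - V q‖ ^ 2) := by
    intro M
    have := (hχ M).continuous
    exact LocBdd.of_continuous_comp hv hp ⟨B, hb⟩
      (G := fun z => χ M z.1.2 * ‖z.2.1 - V z.1‖ ^ 2) (by fun_prop)
  have zY : ∀ (M : ℕ) (τ : ℝ) (x : ℂ), (M + 1 : ℝ) < ‖x‖ →
      (fun q : ℝ × ℂ => χ M q.2 * ‖v q.1 q.2 - V q‖ ^ 2) (τ, x) = 0 :=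
    fun M τ x hx => by simp [hz M x hx]
  have estimate : ∀ᶠ M : ℕ in atTop, ∀ t ∈ Set.Icc 0 T,
      ∫ x, χ M x * ‖v t x - V (t, x)‖ ^ 2 ≤
        2 * (C * (B + 1) * ((∫ τ in (0 : ℝ)..T, ∫ x in A M, ‖v τ x - V (τ, x)‖ ^ 2)
          + ∫ τ in (0 : ℝ)..T, ∫ x in A M, ‖v τ x - V (τ, x)‖ * |p τ x - P (τ, x)|))
        + ∫ s in (0 : ℝ)..t, 2 * g s * ∫ x, χ M x * ‖v s x - V (s, x)‖ ^ 2 := by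
    obtain ⟨N, hN⟩ := exists_nat_gt ρ₀
    filter_upwards [eventually_ge_atTop N] with M hM t ht
    have hNM : ρ₀ < M := hN.trans_le (by exact_mod_cast hM)
    have hψ : ContDiff ℝ 1 (fun q : ℝ × ℂ => θ q.1 * χ M q.2) := by
      have := hχ M
      fun_prop
    have hψc := hasCompactSupport_mul_prod hθc (hχc M)
    have hA := hadm t ht (fun q => θ q.1 * χ M q.2) hψ hψc
      (fun q => ⟨mul_nonneg (hθ01 _).1 (hχ01 M _).1,
        mul_le_one₀ (hθ01 _).2 (hχ01 M _).1 (hχ01 M _).2⟩)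
      ⟨Metric.ball 0 (max ρ₀ T + 1) ×ˢ Metric.ball 0 M,
        Metric.isOpen_ball.prod Metric.isOpen_ball, fun q hq => by
          have hq' := mem_closedBall_zero_iff.1 (hρ₀ hq)
          refine ⟨mem_ball_zero_iff.2 ?_, mem_ball_zero_iff.2 ?_⟩
          · linarith [norm_fst_le q, le_max_left ρ₀ T]
          · linarith [norm_snd_le q], fun q hq => by
          rw [hθ1 _ (mem_ball_zero_iff.1 hq.1), hχ1 M _ (mem_ball_zero_iff.1 hq.2).le, one_mul]⟩
    rw [dissipationPairing_cutoff (hχ M) hθ1 v p ht.1 (hTρ t ht)] at hA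
    have hB := weak_cutoff (hχ M) hθ1 hV hdivfree ht (hTρ t ht)
      (hw _ (hψ.smul hV) hψc.smul_right t ht)
    have h1 := relative_energy_le hV hP hdivfree
      (fun t ht x => euler_dot hV hP (hdivfree t ht x) (hEuler t ht x))
      hv hp ⟨B, hb⟩ hdivv (hχ M) (hz M) ht h0 hA hB
    have h2 := integral_flux_le hV hP hg' hsym' hv hp hb (hχ M) (fun x => (hχ01 M x).1) (hAm M)
      (hAR M) (hz M) (hχC M) (hχS M) ht
    simp only [mul_assoc, intervalIntegral.integral_const_mul] at h1 h2 ⊢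
    linarith
  have hε : Tendsto (fun M : ℕ => 2 * (C * (B + 1) *
      ((∫ τ in (0 : ℝ)..T, ∫ x in A M, ‖v τ x - V (τ, x)‖ ^ 2)
        + ∫ τ in (0 : ℝ)..T, ∫ x in A M, ‖v τ x - V (τ, x)‖ * |p τ x - P (τ, x)|)))
      atTop (𝓝 0) := by
    have hTT : T ∈ Set.Icc 0 T := ⟨hT.le, le_rfl⟩
    simpa using (((hdecay2 T hTT).add (hdecay11 T hTT)).const_mul (C * (B + 1))).const_mul 2
  have hlim := gronwall_tendsto hT.le (hg'.const_mul 2) (fun s hs => by linarith [hg0 s hs])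
    (fun M => (lY M).intervalIntegrable_mul hT.le (zY M) (hg'.const_mul 2))
    (fun M => by
      obtain ⟨D, hD⟩ := (lY M).exists_bound_integral (zY M)
      exact ⟨D, fun s hs => (le_abs_self _).trans (hD s hs)⟩)
    (fun M s _ => integral_nonneg fun x => mul_nonneg (hχ01 M x).1 (sq_nonneg _)) estimate hε
  have hslice : ∀ t ∈ Set.Icc 0 T, ∀ᵐ x, v t x = V (t, x) := by
    intro t ht
    have h := ae_eq_zero_of_tendsto_cutoff (w := fun x => v t x - V (t, x))
      (fun M x => (hχ01 M x).1) hχ1 (fun M => (lY M).integrable_slice ht (zY M)) (hlim t ht)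
    filter_upwards [h] with x hx using sub_eq_zero.1 hx
  rw [Measure.volume_eq_prod, ← Measure.prod_restrict, Measure.restrict_univ,
    Measure.ae_prod_iff_ae_ae (p := fun q : ℝ × ℂ => v q.1 q.2 = V q)
      (measurableSet_eq_fun hv hVc.measurable)]
  filter_upwards [ae_restrict_mem measurableSet_Icc] with t ht using hslice t ht

end
end

section
/- Equi chord-arc lemma: let ℓ > 0, α ∈ (0,1), and let z₀ : ℝ → ℝ² be ℓ-periodic of class C^{2,α} with |z₀′(s)| = 1 for all s and finite chord-arc constant CA(z₀) := sup { |ξ| / |z₀(s+ξ) − z₀(s)| : s ∈ ℝ, 0 < |ξ| ≤ ℓ/2 } < ∞. Let c : ℝ → (0,∞) be ℓ-periodic of class C^{1,α}, let T₁ > 0, and let w : [0,T₁]×ℝ → ℝ² be ℓ-periodic in s, C¹ in s, with sup_{t∈[0,T₁]} ‖w(t,·)‖_{C^{1,α}} < ∞. Set z(t,s) := z₀(s) + t w(t,s) and, for λ ∈ {−1,1}, x_λ(t,s) := z(t,s) + λ t c(s) z₀′(s)^⊥, where (a,b)^⊥ := (−b,a). Then there exists t₀ ∈ (0,T₁] such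 that for all t ∈ [0,t₀], all s ∈ ℝ, all ξ with |ξ| ≤ ℓ/2, and all λ, μ ∈ {−1,1}: |x_μ(t,s+ξ) − x_λ(t,s)| ≥ (1/4) √( CA(z₀)^{−2} ξ² + t² c(s)² (μ−λ)² ). -/
/-- A `C¹` periodic function is globally Lipschitz. -/
theorem Function.Periodic.exists_norm_add_sub_le {E : Type*} [NormedAddCommGroup E]
    [NormedSpace ℝ E] {f : ℝ → E} {p : ℝ} (hf : Function.Periodic f p) (hp : p ≠ 0)
    (hf1 : ContDiff ℝ 1 f) :
    ∃ K, 0 ≤ K ∧ ∀ s ξ : ℝ, ‖f (s + ξ) - f s‖ ≤ K * |ξ| := by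
  have hper : Function.Periodic (deriv f) p := fun x => by
    rw [← deriv_comp_add_const f p x, hf.funext]
  obtain ⟨K, hK⟩ := (hper.isBounded_of_continuous hp
    (hf1.continuous_deriv le_rfl)).exists_norm_le
  refine ⟨K, (norm_nonneg _).trans (hK _ ⟨0, rfl⟩), fun s ξ => ?_⟩
  simpa using convex_univ.norm_image_sub_le_of_norm_deriv_le (𝕜 := ℝ) (f := f) (x := s)
    (y := s + ξ) (fun x _ => hf1.differentiable one_ne_zero x)
    (fun x _ => hK _ ⟨x, rfl⟩) trivial trivial

/-- First order Taylor estimate for a function with Lipschitz derivative. -/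
theorem norm_add_sub_sub_smul_deriv_le {E : Type*} [NormedAddCommGroup E]
    [NormedSpace ℝ E] {f : ℝ → E} (hf : Differentiable ℝ f) {M : ℝ} (hM : 0 ≤ M)
    (hfM : ∀ s ξ : ℝ, ‖deriv f (s + ξ) - deriv f s‖ ≤ M * |ξ|) (s ξ : ℝ) :
    ‖f (s + ξ) - f s - ξ • deriv f s‖ ≤ M * ξ ^ 2 := by
  have hd : ∀ x : ℝ, HasDerivAt (fun y => f (s + y) - y • deriv f s)
      (deriv f (s + x) - deriv f s) x := fun x => by
    have h1 : HasDerivAt (fun y => f (s + y)) (deriv f (s + x)) x :=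
      (hf (s + x)).hasDerivAt.comp_const_add s x
    have h2 : HasDerivAt (fun y : ℝ => y • deriv f s) (deriv f s) x := by
      simpa using (hasDerivAt_id x).smul_const (deriv f s)
    exact h1.sub h2
  have h := (convex_uIcc (0 : ℝ) ξ).norm_image_sub_le_of_norm_hasDerivWithin_le
    (C := M * |ξ|) (fun x _ => (hd x).hasDerivWithinAt) (fun x hx => ?_)
    Set.left_mem_uIcc Set.right_mem_uIcc
  · have h2 : M * |ξ| * ‖ξ - 0‖ = M * ξ ^ 2 := by
      rw [sub_zero, Real.norm_eq_abs, mul_assoc, abs_mul_abs_self, sq]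
    rw [h2] at h
    simpa [sub_right_comm] using h
  · refine (hfM s x).trans (mul_le_mul_of_nonneg_left ?_ hM)
    simpa using Set.abs_sub_left_of_mem_uIcc hx

/-- Pythagoras for `u` a unit complex number and its rotation by a right angle. -/
theorem norm_smul_add_smul_I_mul {u : ℂ} (hu : ‖u‖ = 1) (a b : ℝ) :
    ‖a • u + b • (Complex.I * u)‖ = √(a ^ 2 + b ^ 2) := by
  have h : a • u + b • (Complex.I * u) = ((a : ℂ) + b * Complex.I) * u := by
    simp only [Complex.real_smul]; ring
  rw [h, norm_mul, hu, mul_one, Complex.norm_add_mul_I]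

/-- Lower bound for a chord `d` perturbed by a normal displacement `h` and a small error `e`. -/
theorem quarter_sqrt_le_norm_add {u d e : ℂ} (hu : ‖u‖ = 1) {ξ h CA M ε : ℝ} (hCA : 1 ≤ CA)
    (hM : 0 ≤ M) (hchord : |ξ| ≤ CA * ‖d‖) (hd : ‖d - ξ • u‖ ≤ M * ξ ^ 2)
    (he : ‖e‖ ≤ ε * |ξ|) (hε : 8 * CA * ε ≤ 1) (hh : 4 * M * CA * |h| ≤ 1) :
    1 / 4 * √(ξ ^ 2 / CA ^ 2 + h ^ 2) ≤ ‖d + h • (Complex.I * u) + e‖ := by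
  have hCA0 : 0 < CA := by linarith
  set η := |ξ| / CA with hη
  have hξη : |ξ| = CA * η := by rw [hη]; field_simp
  have hη0 : 0 ≤ η := by positivity
  have hsq : ξ ^ 2 / CA ^ 2 = η ^ 2 := by rw [hη, div_pow, sq_abs]
  have hξ0 := abs_nonneg ξ
  have hh0 := abs_nonneg h
  rw [hsq]
  rcases le_total |h| (η / 2) with hc | hc
  · have h1 : η ≤ ‖d‖ := by
      rw [hη, div_le_iff₀ hCA0]; linarith
    have h2 : ‖h • (Complex.I * u)‖ = |h| := by
      rw [norm_smul, norm_mul, hu, Complex.norm_I, Real.norm_eq_abs]; ring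
    have h3 : ‖e‖ ≤ η / 8 := by
      refine he.trans ?_
      rw [hξη]; nlinarith
    have h4 : ‖d‖ ≤ ‖d + h • (Complex.I * u) + e‖ + ‖h • (Complex.I * u)‖ + ‖e‖ := by
      have h5 := norm_sub_le (d + h • (Complex.I * u) + e - h • (Complex.I * u)) e
      have h6 := norm_sub_le (d + h • (Complex.I * u) + e) (h • (Complex.I * u))
      have h7 : d + h • (Complex.I * u) + e - h • (Complex.I * u) - e = d := by abel
      rw [h7] at h5
      linarith
    have h8 : √(η ^ 2 + h ^ 2) ≤ 3 / 2 * η := by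
      refine Real.sqrt_le_iff.2 ⟨by positivity, ?_⟩
      rw [← sq_abs h]; nlinarith
    linarith
  · have hS := norm_smul_add_smul_I_mul hu ξ h
    set S := √(ξ ^ 2 + h ^ 2) with hSdef
    have h1 : √(η ^ 2 + h ^ 2) ≤ S := by
      refine Real.sqrt_le_sqrt ?_
      rw [← sq_abs ξ, hξη]
      nlinarith [sq_nonneg η, one_le_pow₀ hCA (n := 2)]
    have h2 : |ξ| ≤ S := Real.le_sqrt_of_sq_le (by rw [sq_abs]; nlinarith [sq_nonneg h])
    have h3 : M * ξ ^ 2 ≤ 1 / 2 * |ξ| := by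
      have h9 : M * |ξ| ≤ 1 / 2 := by
        rw [hξη]
        nlinarith [mul_le_mul_of_nonneg_left hc (mul_nonneg hM hCA0.le)]
      rw [← sq_abs ξ]; nlinarith
    have h4 : ‖e‖ ≤ 1 / 8 * |ξ| := by
      refine he.trans (mul_le_mul_of_nonneg_right ?_ hξ0)
      by_contra! h9
      nlinarith
    have h5 : S ≤ ‖d + h • (Complex.I * u) + e‖ + ‖d - ξ • u‖ + ‖e‖ := by
      have h5 := norm_sub_le (d + h • (Complex.I * u) + e - (d - ξ • u)) e
      have h6 := norm_sub_le (d + h • (Complex.I * u) + e) (d - ξ • u)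
      have h7 : d + h • (Complex.I * u) + e - (d - ξ • u) - e
        = ξ • u + h • (Complex.I * u) := by abel
      rw [h7, hS] at h5
      linarith
    linarith


/-- Equi chord-arc lemma: let `z₀` be an `ℓ`-periodic arc-length `C^{2,α}`
curve with chord-arc constant `CA`, let `c > 0` be a `C^{1,α}` expansion speed
and `w` a perturbation, uniformly `C^{1,α}` in `s` on `[0,T₁]`.  With
`z(t,s) = z₀(s) + t w(t,s)` and `x_λ(t,s) = z(t,s) + λ t c(s) z₀'(s)^⊥`, there
is `t₀ ∈ (0,T₁]` such that for `t ∈ [0,t₀]`, `|ξ| ≤ ℓ/2`, `λ, μ ∈ {-1,1}`: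
`|x_μ(t,s+ξ) - x_λ(t,s)| ≥ ¼ √(CA⁻²ξ² + t²c(s)²(μ-λ)²)`. -/
theorem stmt_2 (ℓ : ℝ) (hℓ : 0 < ℓ) (α : ℝ) (hα0 : 0 < α) (hα1 : α < 1)
    (z₀ : ℝ → ℂ) (hz₀per : Function.Periodic z₀ ℓ) (hz₀ : ContDiff ℝ 2 z₀)
    (hz₀arc : ∀ s, ‖deriv z₀ s‖ = 1)
    (Cz : ℝ)
    (hz₀Hol : ∀ s s', ‖iteratedDeriv 2 z₀ s - iteratedDeriv 2 z₀ s'‖ ≤ Cz * |s - s'| ^ α)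
    (CA : ℝ)
    (hCA : ∀ s ξ : ℝ, 0 < |ξ| → |ξ| ≤ ℓ / 2 → |ξ| ≤ CA * ‖z₀ (s + ξ) - z₀ s‖)
    (c : ℝ → ℝ) (hcper : Function.Periodic c ℓ) (hcpos : ∀ s, 0 < c s)
    (hc : ContDiff ℝ 1 c) (Cc : ℝ)
    (hcHol : ∀ s s', |deriv c s - deriv c s'| ≤ Cc * |s - s'| ^ α)
    (T₁ : ℝ) (hT₁ : 0 < T₁)
    (w : ℝ → ℝ → ℂ)
    (hwper : ∀ t ∈ Set.Icc (0 : ℝ) T₁, Function.Periodic (w t) ℓ)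
    (hwC1 : ∀ t ∈ Set.Icc (0 : ℝ) T₁, ContDiff ℝ 1 (w t))
    (Cw : ℝ)
    (hwbnd : ∀ t ∈ Set.Icc (0 : ℝ) T₁, ∀ s, ‖w t s‖ ≤ Cw ∧ ‖deriv (w t) s‖ ≤ Cw)
    (hwHol : ∀ t ∈ Set.Icc (0 : ℝ) T₁, ∀ s s',
      ‖deriv (w t) s - deriv (w t) s'‖ ≤ Cw * |s - s'| ^ α) :
    ∃ t₀ : ℝ, 0 < t₀ ∧ t₀ ≤ T₁ ∧
      ∀ t ∈ Set.Icc (0 : ℝ) t₀, ∀ s ξ : ℝ, |ξ| ≤ ℓ / 2 →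
        ∀ lam mu : ℝ, lam ∈ ({-1, 1} : Set ℝ) → mu ∈ ({-1, 1} : Set ℝ) →
          (1 / 4) * Real.sqrt (ξ ^ 2 / CA ^ 2 + t ^ 2 * c s ^ 2 * (mu - lam) ^ 2) ≤
            ‖(z₀ (s + ξ) + (t : ℝ) • w t (s + ξ)
                + (mu * t * c (s + ξ)) • (Complex.I * deriv z₀ (s + ξ)))
              - (z₀ s + (t : ℝ) • w t s + (lam * t * c s) • (Complex.I * deriv z₀ s))‖ := by
  have hz1 : Differentiable ℝ z₀ := hz₀.differentiable two_ne_zero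
  have hdz : ContDiff ℝ 1 (deriv z₀) := hz₀.deriv' (n := 1)
  have hdzper : Function.Periodic (deriv z₀) ℓ := fun x => by
    rw [← deriv_comp_add_const z₀ ℓ x, hz₀per.funext]
  obtain ⟨M, hM0, hM⟩ := hdzper.exists_norm_add_sub_le hℓ.ne' hdz
  obtain ⟨L, hL0, hL⟩ := Function.Periodic.exists_norm_add_sub_le
    (f := fun s => c s • (Complex.I * deriv z₀ s)) (p := ℓ)
    (fun x => by simp only [hcper x, hdzper x]) hℓ.ne' (hc.smul (contDiff_const.mul hdz))
  obtain ⟨B, hB⟩ := (hcper.isBounded_of_continuous hℓ.ne' hc.continuous).exists_norm_le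
  replace hB : ∀ s, c s ≤ B := fun s => (le_abs_self _).trans (hB _ ⟨s, rfl⟩)
  have hB0 : 0 < B := (hcpos 0).trans_le (hB 0)
  have hCw0 : 0 ≤ Cw := (norm_nonneg _).trans (hwbnd 0 ⟨le_rfl, hT₁.le⟩ 0).1
  have hCA1 : 1 ≤ CA := by
    have hℓ2 : |ℓ / 2| = ℓ / 2 := abs_of_pos (by positivity)
    have h1 := hCA 0 (ℓ / 2) (by rw [hℓ2]; positivity) hℓ2.le
    have h2 : ‖z₀ (0 + ℓ / 2) - z₀ 0‖ ≤ ℓ / 2 := by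
      simpa [hℓ2, abs_of_pos hℓ] using convex_univ.norm_image_sub_le_of_norm_deriv_le (𝕜 := ℝ)
        (f := z₀) (x := 0) (y := 0 + ℓ / 2) (fun x _ => hz1 x)
        (fun x _ => (hz₀arc x).le) trivial trivial
    rw [hℓ2] at h1
    have h3 := norm_nonneg (z₀ (0 + ℓ / 2) - z₀ 0)
    have h4 : 0 < CA := by
      by_contra! h4
      nlinarith
    nlinarith
  set P := 8 * CA * (Cw + L) + 8 * M * CA * B + 1 with hP
  have hP0 : 0 < P := by positivity
  refine ⟨min T₁ (1 / P), lt_min hT₁ (by positivity), min_le_left _ _, ?_⟩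
  rintro t ⟨ht0, ht⟩ s ξ hξ lam mu hlam hmu
  have htT : t ∈ Set.Icc 0 T₁ := ⟨ht0, ht.trans (min_le_left _ _)⟩
  have htP : t * P ≤ 1 := (le_div_iff₀ hP0).1 (ht.trans (min_le_right _ _))
  have hmu1 : |mu| = 1 := by rcases hmu with rfl | rfl <;> norm_num
  have hdiff : |mu - lam| ≤ 2 := by
    rcases hmu with rfl | rfl <;> rcases hlam with rfl | rfl <;> norm_num
  have hw : ‖w t (s + ξ) - w t s‖ ≤ Cw * |ξ| := by
    simpa using convex_univ.norm_image_sub_le_of_norm_deriv_le (𝕜 := ℝ) (f := w t) (x := s)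
      (y := s + ξ) (fun x _ => (hwC1 t htT).differentiable one_ne_zero x)
      (fun x _ => (hwbnd t htT x).2) trivial trivial
  have hchord : |ξ| ≤ CA * ‖z₀ (s + ξ) - z₀ s‖ := by
    rcases (abs_nonneg ξ).eq_or_lt with h0 | h0
    · rw [← h0]; positivity
    · exact hCA s ξ h0 hξ
  have hp1 : 0 ≤ t * (8 * CA * (Cw + L)) := by positivity
  have hp2 : 0 ≤ t * (8 * M * CA * B) := by positivity
  have htP' : t * (8 * CA * (Cw + L)) + t * (8 * M * CA * B) + t ≤ 1 := by
    rw [hP] at htP; linarith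
  have key := quarter_sqrt_le_norm_add (u := deriv z₀ s) (d := z₀ (s + ξ) - z₀ s)
    (e := t • (w t (s + ξ) - w t s) + (mu * t) • (c (s + ξ) • (Complex.I * deriv z₀ (s + ξ))
      - c s • (Complex.I * deriv z₀ s))) (h := t * c s * (mu - lam)) (ε := t * (Cw + L))
    (hz₀arc s) hCA1 hM0 hchord (norm_add_sub_sub_smul_deriv_le hz1 hM0 hM s ξ)
    ((norm_add_le _ _).trans ?_) (by linarith) ?_
  · convert key using 2
    · ring_nf
    · simp only [Complex.real_smul]; push_cast; ring
  · rw [norm_smul, norm_smul, Real.norm_eq_abs, Real.norm_eq_abs, abs_mul, hmu1,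
      abs_of_nonneg ht0, one_mul]
    nlinarith [mul_le_mul_of_nonneg_left hw ht0, mul_le_mul_of_nonneg_left (hL s ξ) ht0]
  · rw [abs_mul, abs_mul, abs_of_nonneg ht0, abs_of_pos (hcpos s)]
    have h1 : t * c s * |mu - lam| ≤ t * B * 2 :=
      mul_le_mul (mul_le_mul_of_nonneg_left (hB s) ht0) hdiff (abs_nonneg _) (by positivity)
    nlinarith [mul_le_mul_of_nonneg_left h1 (show 0 ≤ 4 * M * CA by positivity)]
end
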